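/- arXiv:math/0702263 — 2 statements merged into one kernel-verified Lean document; each statement's English description precedes it below -/
import Mathlib

section
/- (Comparison principle under (A3-2).) Assume j(·,z) is continuous on ℝ^d for every z and that (A1), (A2), (A3-2) and (A4) hold. If u is a bounded usc viscosity subsolution of F(x,w,∇w,D²w,I_LI[x,w]) = 0 on ℝ^d and v is a bounded lsc viscosity supersolution of the same equation, then u(x) ≤ v(x) for all x∈ℝ^d. -/
open scoped RealInnerProductSpace
open Filter Metric MeasureTheory Topology

/-- The Lévy–Itô operator `I_LI[x,φ]`. -/
noncomputable def ILI {d : ℕ} (μ : Measure (EuclideanSpace ℝ (Fin d)))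
    (j : EuclideanSpace ℝ (Fin d) → EuclideanSpace ℝ (Fin d) → EuclideanSpace ℝ (Fin d))
    (x : EuclideanSpace ℝ (Fin d)) (φ : EuclideanSpace ℝ (Fin d) → ℝ) : ℝ :=
  ∫ z, (φ (x + j x z) - φ x -
    ⟪gradient φ x, j x z⟫ *
      (closedBall (0 : EuclideanSpace ℝ (Fin d)) 1).indicator (fun _ => (1:ℝ)) z) ∂μ

/-- The Hessian matrix of `φ` at `x`. -/
noncomputable def hessM {d : ℕ} (φ : EuclideanSpace ℝ (Fin d) → ℝ)
    (x : EuclideanSpace ℝ (Fin d)) : Matrix (Fin d) (Fin d) ℝ :=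
  Matrix.of fun i j =>
    iteratedFDeriv ℝ 2 φ x ![EuclideanSpace.single i 1, EuclideanSpace.single j 1]

/-- Degenerate ellipticity of `F`. -/
def DegEll {d : ℕ}
    (F : EuclideanSpace ℝ (Fin d) → ℝ → EuclideanSpace ℝ (Fin d) →
      Matrix (Fin d) (Fin d) ℝ → ℝ → ℝ) : Prop :=
  ∀ x u p (M N : Matrix (Fin d) (Fin d) ℝ) (l₁ l₂ : ℝ),
    (M - N).PosSemidef → l₂ ≤ l₁ → F x u p M l₁ ≤ F x u p N l₂

/-- Viscosity subsolution (bounded usc functions, bounded `C²` test functions). -/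
def IsSubsolution {d : ℕ}
    (F : EuclideanSpace ℝ (Fin d) → ℝ → EuclideanSpace ℝ (Fin d) →
      Matrix (Fin d) (Fin d) ℝ → ℝ → ℝ)
    (μ : Measure (EuclideanSpace ℝ (Fin d)))
    (j : EuclideanSpace ℝ (Fin d) → EuclideanSpace ℝ (Fin d) → EuclideanSpace ℝ (Fin d))
    (u : EuclideanSpace ℝ (Fin d) → ℝ) : Prop :=
  ∀ φ : EuclideanSpace ℝ (Fin d) → ℝ, ContDiff ℝ 2 φ → (∃ C, ∀ y, |φ y| ≤ C) →
    ∀ x : EuclideanSpace ℝ (Fin d), (∀ y, u y - φ y ≤ u x - φ x) →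
      F x (u x) (gradient φ x) (hessM φ x) (ILI μ j x φ) ≤ 0

/-- Viscosity supersolution. -/
def IsSupersolution {d : ℕ}
    (F : EuclideanSpace ℝ (Fin d) → ℝ → EuclideanSpace ℝ (Fin d) →
      Matrix (Fin d) (Fin d) ℝ → ℝ → ℝ)
    (μ : Measure (EuclideanSpace ℝ (Fin d)))
    (j : EuclideanSpace ℝ (Fin d) → EuclideanSpace ℝ (Fin d) → EuclideanSpace ℝ (Fin d))
    (v : EuclideanSpace ℝ (Fin d) → ℝ) : Prop :=
  ∀ φ : EuclideanSpace ℝ (Fin d) → ℝ, ContDiff ℝ 2 φ → (∃ C, ∀ y, |φ y| ≤ C) →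
    ∀ x : EuclideanSpace ℝ (Fin d), (∀ y, v x - φ x ≤ v y - φ y) →
      F x (v x) (gradient φ x) (hessM φ x) (ILI μ j x φ) ≥ 0

/-- The quadratic form `z ↦ ⟨Az, z⟩` of a matrix `A`. -/
noncomputable def quadF {d : ℕ} (A : Matrix (Fin d) (Fin d) ℝ)
    (z : EuclideanSpace ℝ (Fin d)) : ℝ :=
  ⟪Matrix.toEuclideanLin A z, z⟫

/-- A modulus of continuity: nonnegative, nondecreasing on `[0,∞)`, vanishing and
continuous at `0`. -/
def IsModulus (ω : ℝ → ℝ) : Prop :=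
  (∀ s, 0 ≤ ω s) ∧ MonotoneOn ω (Set.Ici 0) ∧ ω 0 = 0 ∧ ContinuousWithinAt ω (Set.Ici 0) 0

section Semiconvex

variable {E : Type*} [NormedAddCommGroup E] [InnerProductSpace ℝ E]

/-- `g` selects, at every point, the slope of a paraboloid of opening `2c` touching `U` from
below. -/
def IsSemiconvexWith (c : ℝ) (U : E → ℝ) (g : E → E) : Prop :=
  ∀ z y, U z + ⟪g z, y - z⟫ - c * ‖y - z‖ ^ 2 ≤ U y

/-- If a semiconvex function is touched from above by a paraboloid at `k`, then its
subgradients are Lipschitz at `k`. -/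
lemma IsSemiconvexWith.norm_sub_le {c C : ℝ} {U : E → ℝ} {g : E → E}
    (hU : IsSemiconvexWith c U g) (hC : 0 ≤ C) {k : E}
    (hk : ∀ y, U y ≤ U k + ⟪g k, y - k⟫ + C * ‖y - k‖ ^ 2) (z : E) :
    ‖g z - g k‖ ≤ (4 * C + 2 * c) * ‖z - k‖ := by
  set ρ := ‖z - k‖ with hρ
  rcases eq_or_ne (g z) (g k) with h | h
  · rcases eq_or_ne z k with rfl | hzk
    · simp [hρ]
    · have hpos : 0 < ρ ^ 2 := by
        have : 0 < ρ := norm_pos_iff.2 (sub_ne_zero.2 hzk)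
        positivity
      have h1 := hU k z
      have h2 := hk z
      rw [← hρ] at h1 h2
      have h3 : 0 ≤ C + c := by nlinarith
      rw [h, sub_self, norm_zero]
      have : 0 ≤ ρ := norm_nonneg _
      apply mul_nonneg _ this
      linarith
  · have hΔ : 0 < ‖g z - g k‖ := norm_pos_iff.2 (sub_ne_zero.2 h)
    set Δ := g z - g k with hΔdef
    rcases eq_or_ne z k with rfl | hzk
    · exact absurd rfl h
    have hρ0 : 0 < ρ := norm_pos_iff.2 (sub_ne_zero.2 hzk)
    set e : E := (ρ / ‖Δ‖) • Δ with he
    have hen : ‖e‖ = ρ := by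
      rw [he, norm_smul, Real.norm_of_nonneg (by positivity)]
      field_simp
    have hie : ⟪Δ, e⟫ = ρ * ‖Δ‖ := by
      rw [he, inner_smul_right, real_inner_self_eq_norm_sq]
      field_simp
    have h1 := hU z (z + e)
    have h2 := hU k z
    have h3 := hk (z + e)
    have h4 : ‖z + e - k‖ ≤ 2 * ρ := by
      calc ‖z + e - k‖ = ‖(z - k) + e‖ := by congr 1; abel
        _ ≤ ‖z - k‖ + ‖e‖ := norm_add_le _ _
        _ = 2 * ρ := by rw [hen, ← hρ]; ring
    have h5 : ‖z + e - k‖ ^ 2 ≤ 4 * ρ ^ 2 := by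
      nlinarith [norm_nonneg (z + e - k)]
    have h6 : ⟪g k, z + e - k⟫ = ⟪g k, z - k⟫ + ⟪g k, e⟫ := by
      rw [← inner_add_right]; congr 1; abel
    have h7 : ⟪g z, e⟫ = ⟪g k, e⟫ + ρ * ‖Δ‖ := by
      rw [← hie, hΔdef, inner_sub_left]; ring
    rw [add_sub_cancel_left, hen, h7] at h1
    rw [← hρ] at h2
    rw [h6] at h3
    have h8 : ρ * ‖Δ‖ ≤ (4 * C + 2 * c) * ρ * ρ := by nlinarith
    nlinarith

/-- A function that is Lipschitz at every point of `K`, with a uniform constant, is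
differentiable at almost every point of `K`. -/
lemma ae_differentiableAt_of_lipschitz_at [FiniteDimensional ℝ E] [MeasurableSpace E]
    [BorelSpace E] (ν : Measure E) [ν.IsAddHaarMeasure] {G : Type*} [NormedAddCommGroup G]
    [NormedSpace ℝ G] [FiniteDimensional ℝ G] {g : E → G} {K : Set E} {Λ : ℝ}
    (hg : ∀ k ∈ K, ∀ z, ‖g z - g k‖ ≤ Λ * ‖z - k‖) :
    ∀ᵐ k ∂ν, k ∈ K → DifferentiableAt ℝ g k := by
  have hL : LipschitzOnWith Λ.toNNReal g K := by
    refine LipschitzOnWith.of_dist_le_mul fun x _ y hy => ?_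
    rw [dist_eq_norm, dist_eq_norm]
    refine (hg y hy x).trans ?_
    gcongr
    exact Real.le_coe_toNNReal Λ
  obtain ⟨f, hf, hfg⟩ := hL.extend_finite_dimension
  set D := lipschitzExtensionConstant G * Λ.toNNReal with hD
  filter_upwards [hf.ae_differentiableAt (μ := ν),
    (Metric.lipschitz_infDist_pt K).ae_differentiableAt (μ := ν)] with k hfk hdk hkK
  have hder : HasFDerivAt (fun x => infDist x K) (0 : E →L[ℝ] ℝ) k := by
    have hmin : IsLocalMin (fun x => infDist x K) k := by
      refine Eventually.of_forall fun x => ?_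
      simp only [infDist_zero_of_mem hkK]
      exact infDist_nonneg
    have := hdk.hasFDerivAt
    rwa [hmin.fderiv_eq_zero] at this
  have hbound : ∀ z, ‖g z - f z‖ ≤ (|Λ| + D) * infDist z K := by
    intro z
    by_contra! hcon
    have hne : K.Nonempty := ⟨k, hkK⟩
    have h0 : 0 < |Λ| + D + 1 := by positivity
    obtain ⟨δ, hδ, hlt⟩ : ∃ δ > 0, (|Λ| + D) * (infDist z K + δ) < ‖g z - f z‖ := by
      refine ⟨(‖g z - f z‖ - (|Λ| + D) * infDist z K) / (|Λ| + D + 1), by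
        apply div_pos _ h0; linarith, ?_⟩
      have : (|Λ| + D) * ((‖g z - f z‖ - (|Λ| + D) * infDist z K) / (|Λ| + D + 1))
          < ‖g z - f z‖ - (|Λ| + D) * infDist z K := by
        rw [mul_div_assoc', div_lt_iff₀ h0]
        nlinarith
      linarith
    obtain ⟨k', hk', hd⟩ := (infDist_lt_iff (x := z) hne).1
      (show infDist z K < infDist z K + δ by linarith)
    have h1 : ‖g z - f z‖ ≤ ‖g z - g k'‖ + ‖f k' - f z‖ := by
      calc ‖g z - f z‖ = ‖(g z - g k') + (f k' - f z)‖ := by rw [hfg hk']; congr 1; abel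
        _ ≤ _ := norm_add_le _ _
    have h2 := hg k' hk' z
    have h3 := hf.dist_le_mul k' z
    rw [dist_eq_norm, dist_comm, ] at h3
    rw [dist_eq_norm] at hd h3
    have h4 : Λ * ‖z - k'‖ ≤ |Λ| * ‖z - k'‖ := by gcongr; exact le_abs_self Λ
    have h5 : (|Λ| + D) * ‖z - k'‖ ≤ (|Λ| + D) * (infDist z K + δ) := by
      gcongr
    nlinarith
  have hdiff : HasFDerivAt (fun z => g z - f z) (0 : E →L[ℝ] G) k := by
    rw [hasFDerivAt_iff_isLittleO_nhds_zero] at hder ⊢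
    refine Asymptotics.IsBigO.trans_isLittleO ?_ hder
    refine Asymptotics.IsBigO.of_bound (|Λ| + D) (Eventually.of_forall fun h => ?_)
    have := hbound (k + h)
    simpa [hfg hkK, infDist_zero_of_mem hkK, abs_of_nonneg infDist_nonneg] using this
  have := (hdiff.add hfk.hasFDerivAt).differentiableAt
  convert this using 1
  ext z
  simp

/-- Second-order Taylor expansion of a semiconvex function at a point where its subgradient is
differentiable. -/
lemma IsSemiconvexWith.taylor {c : ℝ} {U : E → ℝ} {g : E → E}
    (hU : IsSemiconvexWith c U g) (hc : 0 ≤ c) {k : E} {A : E →L[ℝ] E}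
    (hA : HasFDerivAt g A k) {θ : ℝ} (hθ : 0 < θ) :
    ∀ᶠ h in 𝓝 (0 : E), |U (k + h) - U k - ⟪g k, h⟫ - 1 / 2 * ⟪A h, h⟫| ≤ θ * ‖h‖ ^ 2 := by
  obtain ⟨N, hN⟩ := exists_nat_gt ((c + ‖A‖) / (θ / 2))
  have hN0 : (0 : ℝ) < N := lt_of_le_of_lt (by positivity) hN
  rw [div_lt_iff₀ (by positivity)] at hN
  rw [hasFDerivAt_iff_isLittleO_nhds_zero, Asymptotics.isLittleO_iff] at hA
  obtain ⟨r, hr, hball⟩ := Metric.eventually_nhds_iff.1 (hA (show (0 : ℝ) < θ / 2 by positivity))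
  filter_upwards [Metric.ball_mem_nhds (0 : E) hr] with h hh
  have hhr : ‖h‖ < r := by simpa using hh
  have hg : ∀ t : ℝ, 0 ≤ t → t ≤ 1 →
      |⟪g (k + t • h), h⟫ - ⟪g k, h⟫ - t * ⟪A h, h⟫| ≤ θ / 2 * ‖h‖ ^ 2 := by
    intro t ht0 ht1
    have hth : ‖t • h‖ ≤ ‖h‖ := by
      rw [norm_smul, Real.norm_of_nonneg ht0]
      exact mul_le_of_le_one_left (norm_nonneg _) ht1
    have h1 := hball (y := t • h) (by simpa using hth.trans_lt hhr)
    have h2 : ⟪g (k + t • h), h⟫ - ⟪g k, h⟫ - t * ⟪A h, h⟫ =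
        ⟪g (k + t • h) - g k - A (t • h), h⟫ := by
      simp [inner_sub_left, inner_smul_left]
    rw [h2]
    calc _ ≤ ‖g (k + t • h) - g k - A (t • h)‖ * ‖h‖ := abs_real_inner_le_norm _ _
      _ ≤ θ / 2 * ‖t • h‖ * ‖h‖ := by gcongr
      _ ≤ θ / 2 * ‖h‖ * ‖h‖ := by gcongr
      _ = _ := by ring
  have hAh : |⟪A h, h⟫| ≤ ‖A‖ * ‖h‖ ^ 2 := by
    calc _ ≤ ‖A h‖ * ‖h‖ := abs_real_inner_le_norm _ _
      _ ≤ ‖A‖ * ‖h‖ * ‖h‖ := by gcongr; exact A.le_opNorm h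
      _ = _ := by ring
  have key : ∀ i : ℕ, i ≤ N →
      |U (k + ((i : ℝ) / N) • h) - U k - (i : ℝ) / N * ⟪g k, h⟫
        - 1 / 2 * ((i : ℝ) / N) ^ 2 * ⟪A h, h⟫| ≤
      (i : ℝ) / N * (θ / 2 * ‖h‖ ^ 2 + (c + ‖A‖) / N * ‖h‖ ^ 2) := by
    intro i
    induction i with
    | zero => intro _; simp
    | succ i ih =>
      intro hi
      have hiN : ((i : ℝ) + 1) ≤ N := by exact_mod_cast hi
      have hi' := ih (by omega)
      set a : ℝ := (i : ℝ) / N with ha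
      set τ : ℝ := 1 / (N : ℝ) with hτ
      have hτ0 : 0 < τ := by positivity
      have hb : ((i + 1 : ℕ) : ℝ) / N = a + τ := by rw [ha, hτ]; push_cast; ring
      have ha0 : 0 ≤ a := by positivity
      have hb1 : a + τ ≤ 1 := by
        rw [← hb, div_le_one hN0]; push_cast; exact hiN
      rw [hb]
      have e1 : (k + (a + τ) • h) - (k + a • h) = τ • h := by rw [add_smul]; abel
      have e2 : (k + a • h) - (k + (a + τ) • h) = -(τ • h) := by rw [add_smul]; abel
      have l1 := hU (k + a • h) (k + (a + τ) • h)
      have l2 := hU (k + (a + τ) • h) (k + a • h)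
      rw [e1, inner_smul_right, norm_smul, Real.norm_of_nonneg hτ0.le] at l1
      rw [e2, inner_neg_right, inner_smul_right, norm_neg, norm_smul,
        Real.norm_of_nonneg hτ0.le] at l2
      have g1 := abs_le.1 (hg a ha0 (by linarith))
      have g2 := abs_le.1 (hg (a + τ) (by linarith) hb1)
      have hA' := abs_le.1 hAh
      rw [abs_le] at hi' ⊢
      have hdiv : (c + ‖A‖) / N = τ * (c + ‖A‖) := by rw [hτ]; ring
      rw [hdiv] at hi' ⊢
      set P := ⟪g k, h⟫
      set Q := ⟪A h, h⟫
      set n2 := ‖h‖ ^ 2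
      have hn2 : 0 ≤ n2 := by positivity
      have m1 := mul_le_mul_of_nonneg_left g1.1 hτ0.le
      have m2 := mul_le_mul_of_nonneg_left g2.2 hτ0.le
      have q1 := mul_le_mul_of_nonneg_left hA'.1 (sq_nonneg τ)
      have q2 := mul_le_mul_of_nonneg_left hA'.2 (sq_nonneg τ)
      have e3 : (τ * ‖h‖) ^ 2 = τ ^ 2 * n2 := by ring
      rw [e3] at l1 l2
      have hAn : 0 ≤ τ ^ 2 * (‖A‖ * n2) := by positivity
      constructor <;> nlinarith
  have := key N le_rfl
  rw [div_self hN0.ne'] at this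
  simp only [one_smul, one_mul, one_pow, mul_one] at this
  refine this.trans ?_
  have : (c + ‖A‖) / N ≤ θ / 2 := by
    rw [div_le_iff₀ hN0]; linarith
  nlinarith [sq_nonneg ‖h‖]

end Semiconvex

section SupConvolution

variable {E : Type*} [NormedAddCommGroup E]

/-- The sup-convolution of `u` with parameter `s`. -/
noncomputable def supConv (u : E → ℝ) (s : ℝ) (z : E) : ℝ :=
  ⨆ x, (u x - ‖x - z‖ ^ 2 / (2 * s))

variable {u : E → ℝ} {M s : ℝ}

lemma le_supConv (hM : ∀ x, |u x| ≤ M) (hs : 0 < s) (x z : E) :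
    u x - ‖x - z‖ ^ 2 / (2 * s) ≤ supConv u s z := by
  refine le_ciSup (f := fun x => u x - ‖x - z‖ ^ 2 / (2 * s)) ⟨M, ?_⟩ x
  rintro _ ⟨y, rfl⟩
  have h1 := (abs_le.1 (hM y)).2
  have h2 : 0 ≤ ‖y - z‖ ^ 2 / (2 * s) := by positivity
  simp only
  linarith

lemma self_le_supConv (hM : ∀ x, |u x| ≤ M) (hs : 0 < s) (z : E) : u z ≤ supConv u s z := by
  simpa using le_supConv hM hs z z

lemma supConv_le (hM : ∀ x, |u x| ≤ M) (hs : 0 < s) (z : E) : supConv u s z ≤ M := by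
  refine ciSup_le fun y => ?_
  have h1 := (abs_le.1 (hM y)).2
  have h2 : 0 ≤ ‖y - z‖ ^ 2 / (2 * s) := by positivity
  linarith

lemma norm_argmax_sub_sq_le (hM : ∀ x, |u x| ≤ M) (hs : 0 < s) {x z : E}
    (hx : supConv u s z = u x - ‖x - z‖ ^ 2 / (2 * s)) : ‖x - z‖ ^ 2 ≤ 4 * M * s := by
  have h1 := self_le_supConv hM hs z
  have h2 := (abs_le.1 (hM z)).1
  have h3 := (abs_le.1 (hM x)).2
  have h4 : ‖x - z‖ ^ 2 / (2 * s) ≤ 2 * M := by linarith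
  rw [div_le_iff₀ (by positivity)] at h4
  linarith

/-- Monotonicity of the sup-convolution in its parameter, in quantitative form. -/
lemma supConv_add_le_supConv_two_mul (hM : ∀ x, |u x| ≤ M) (hs : 0 < s) {x z : E}
    (hx : supConv u s z = u x - ‖x - z‖ ^ 2 / (2 * s)) :
    supConv u s z + ‖x - z‖ ^ 2 / (4 * s) ≤ supConv u (2 * s) z := by
  have h1 := le_supConv hM (show 0 < 2 * s by linarith) x z
  rw [hx]
  refine le_trans (le_of_eq ?_) h1
  field_simp
  ring

variable [InnerProductSpace ℝ E]

lemma exists_supConv_eq [FiniteDimensional ℝ E] (hu : UpperSemicontinuous u)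
    (hM : ∀ x, |u x| ≤ M) (hs : 0 < s) (z : E) :
    ∃ x, supConv u s z = u x - ‖x - z‖ ^ 2 / (2 * s) := by
  have hM0 : 0 ≤ M := (abs_nonneg _).trans (hM z)
  set r := Real.sqrt (4 * M * s) with hr
  have hr2 : r ^ 2 = 4 * M * s := Real.sq_sqrt (by positivity)
  have hr0 : 0 ≤ r := Real.sqrt_nonneg _
  have husc : UpperSemicontinuous fun x => u x - ‖x - z‖ ^ 2 / (2 * s) := by
    have hc : Continuous fun x : E => -(‖x - z‖ ^ 2 / (2 * s)) := by fun_prop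
    simpa [sub_eq_add_neg] using hu.add hc.upperSemicontinuous
  obtain ⟨x, _, hx⟩ := (husc.upperSemicontinuousOn (closedBall z r)).exists_isMaxOn
    ⟨z, mem_closedBall_self hr0⟩ (isCompact_closedBall z r)
  refine ⟨x, le_antisymm (ciSup_le fun y => ?_) (le_supConv hM hs x z)⟩
  rcases le_or_gt ‖y - z‖ r with hy | hy
  · exact hx (by simpa [mem_closedBall, dist_eq_norm] using hy)
  · have h0 : u z - ‖z - z‖ ^ 2 / (2 * s) ≤ u x - ‖x - z‖ ^ 2 / (2 * s) :=
      hx (mem_closedBall_self hr0)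
    have h1 := (abs_le.1 (hM y)).2
    have h2 := (abs_le.1 (hM z)).1
    have h3 : 2 * M ≤ ‖y - z‖ ^ 2 / (2 * s) := by
      rw [le_div_iff₀ (by positivity)]
      nlinarith
    simp only [sub_self, norm_zero] at h0
    norm_num at h0
    linarith

/-- Slopes of the sup-convolution, read off from its maximisers. -/
lemma isSemiconvexWith_supConv (hM : ∀ x, |u x| ≤ M) (hs : 0 < s) {m : E → E}
    (hm : ∀ z, supConv u s z = u (m z) - ‖m z - z‖ ^ 2 / (2 * s)) :
    IsSemiconvexWith (1 / (2 * s)) (supConv u s) fun z => (1 / s) • (m z - z) := by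
  intro z y
  have h1 := le_supConv hM hs (m z) y
  have h2 : ‖m z - y‖ ^ 2 = ‖m z - z‖ ^ 2 - 2 * ⟪m z - z, y - z⟫ + ‖y - z‖ ^ 2 := by
    rw [← norm_sub_sq_real]; congr 2; abel
  rw [hm z]
  refine le_trans (le_of_eq ?_) h1
  rw [h2, inner_smul_left]
  simp
  field_simp
  ring

lemma continuous_supConv [FiniteDimensional ℝ E] (hu : UpperSemicontinuous u)
    (hM : ∀ x, |u x| ≤ M) (hs : 0 < s) : Continuous (supConv u s) := by
  choose m hm using exists_supConv_eq hu hM hs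
  have hsc := isSemiconvexWith_supConv hM hs hm
  set G := 1 / s * Real.sqrt (4 * M * s) with hG
  have hgb : ∀ z, ‖(1 / s) • (m z - z)‖ ≤ G := by
    intro z
    rw [norm_smul, Real.norm_of_nonneg (by positivity)]
    rw [hG]
    gcongr
    exact Real.le_sqrt_of_sq_le (norm_argmax_sub_sq_le hM hs (hm z))
  have hstep : ∀ z y, supConv u s z - supConv u s y ≤
      G * ‖y - z‖ + 1 / (2 * s) * ‖y - z‖ ^ 2 := by
    intro z y
    have h1 := hsc z y
    have h2 := (abs_le.1 (abs_real_inner_le_norm ((1 / s) • (m z - z)) (y - z))).1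
    have h3 := mul_le_mul_of_nonneg_right (hgb z) (norm_nonneg (y - z))
    simp only at h1
    linarith
  rw [continuous_iff_continuousAt]
  intro z
  rw [ContinuousAt, tendsto_iff_norm_sub_tendsto_zero]
  have hlim : Tendsto (fun y => G * ‖y - z‖ + 1 / (2 * s) * ‖y - z‖ ^ 2) (𝓝 z) (𝓝 0) := by
    have : Continuous fun y => G * ‖y - z‖ + 1 / (2 * s) * ‖y - z‖ ^ 2 := by fun_prop
    simpa using this.tendsto z
  refine squeeze_zero (fun _ => norm_nonneg _) (fun y => ?_) hlim
  rw [Real.norm_eq_abs, abs_le]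
  have h1 := hstep z y
  have h2 := hstep y z
  rw [norm_sub_rev z y] at h2
  constructor <;> linarith

lemma tendsto_supConv [FiniteDimensional ℝ E] (hu : UpperSemicontinuous u)
    (hM : ∀ x, |u x| ≤ M) (z : E) :
    Tendsto (fun n : ℕ => supConv u (1 / ((n : ℝ) + 1)) z) atTop (𝓝 (u z)) := by
  have hs : ∀ n : ℕ, 0 < 1 / ((n : ℝ) + 1) := fun n => by positivity
  choose m hm using fun n : ℕ => exists_supConv_eq hu hM (hs n) z
  have hmz : Tendsto m atTop (𝓝 z) := by
    rw [tendsto_iff_norm_sub_tendsto_zero]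
    have h1 : Tendsto (fun n : ℕ => Real.sqrt (4 * M * (1 / ((n : ℝ) + 1)))) atTop (𝓝 0) := by
      have : Tendsto (fun n : ℕ => 4 * M * (1 / ((n : ℝ) + 1))) atTop (𝓝 0) := by
        simpa using (tendsto_one_div_add_atTop_nhds_zero_nat (𝕜 := ℝ)).const_mul (4 * M)
      simpa using this.sqrt
    exact squeeze_zero (fun _ => norm_nonneg _)
      (fun n => Real.le_sqrt_of_sq_le (norm_argmax_sub_sq_le hM (hs n) (hm n))) h1
  rw [tendsto_order]
  refine ⟨fun a ha => Eventually.of_forall fun n =>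
    ha.trans_le (self_le_supConv hM (hs n) z), fun a ha => ?_⟩
  filter_upwards [hmz.eventually (hu z a ha)] with n hn
  have h0 := hs n
  have : 0 ≤ ‖m n - z‖ ^ 2 / (2 * (1 / ((n : ℝ) + 1))) := by positivity
  rw [hm n]
  linarith

end SupConvolution

section TouchingPoint

variable {E : Type*} [NormedAddCommGroup E] [InnerProductSpace ℝ E]

lemma eq_zero_of_inner_le_mul_norm_sq {v : E} {C : ℝ} (h : ∀ w, ⟪v, w⟫ ≤ C * ‖w‖ ^ 2) :
    v = 0 := by
  have h1 := h ((1 / (2 * (|C| + 1))) • v)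
  rw [inner_smul_right, real_inner_self_eq_norm_sq, norm_smul, Real.norm_of_nonneg (by positivity),
    mul_pow] at h1
  have hC : C ≤ |C| := le_abs_self C
  have h0 : 0 < |C| + 1 := by positivity
  have h2 : C * ((1 / (2 * (|C| + 1))) ^ 2 * ‖v‖ ^ 2) ≤
      (|C| + 1) * ((1 / (2 * (|C| + 1))) ^ 2 * ‖v‖ ^ 2) := by
    gcongr
    linarith
  have h3 : (|C| + 1) * ((1 / (2 * (|C| + 1))) ^ 2 * ‖v‖ ^ 2) =
      1 / 2 * (1 / (2 * (|C| + 1)) * ‖v‖ ^ 2) := by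
    field_simp
  have h4 : 1 / (2 * (|C| + 1)) * ‖v‖ ^ 2 ≤ 0 := by linarith
  have h5 : ‖v‖ ^ 2 ≤ 0 := by
    by_contra! hpos
    have : 0 < 1 / (2 * (|C| + 1)) * ‖v‖ ^ 2 := by positivity
    linarith
  have : ‖v‖ = 0 := by nlinarith [norm_nonneg v]
  exact norm_eq_zero.1 this

/-- The point `z` maximises `Φ` minus the truncated paraboloid of opening `2β` centred at `q`. -/
def IsTouching (β : ℝ) (Φ : E → ℝ) (q z : E) : Prop :=
  ‖z - q‖ < 1 ∧ ∀ y, Φ y ≤ Φ z + β * (min (‖y - q‖ ^ 2) 1 - ‖z - q‖ ^ 2)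

lemma IsTouching.le_add_inner {β : ℝ} {Φ : E → ℝ} {q z : E} (h : IsTouching β Φ q z)
    (hβ : 0 ≤ β) (y : E) :
    Φ y ≤ Φ z + ⟪(2 * β) • (z - q), y - z⟫ + β * ‖y - z‖ ^ 2 := by
  have h1 := h.2 y
  have h2 : ‖y - q‖ ^ 2 = ‖z - q‖ ^ 2 + 2 * ⟪z - q, y - z⟫ + ‖y - z‖ ^ 2 := by
    rw [← norm_add_sq_real]; congr 2; abel
  have h3 : β * (min (‖y - q‖ ^ 2) 1 - ‖z - q‖ ^ 2) ≤ β * (‖y - q‖ ^ 2 - ‖z - q‖ ^ 2) := by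
    gcongr
    exact min_le_left _ _
  rw [inner_smul_left]
  simp only [conj_trivial]
  rw [h2] at h1 h3
  nlinarith

lemma exists_isTouching [FiniteDimensional ℝ E] {β : ℝ} (hβ : 0 < β) {Φ : E → ℝ}
    (hΦ : Continuous Φ) {z₀ q : E} (hz₀ : ∀ z, Φ z ≤ Φ z₀ + β / 2) (hq : ‖q - z₀‖ < 1 / 2) :
    ∃ z, IsTouching β Φ q z ∧ Φ z₀ - β / 4 ≤ Φ z - β * ‖z - q‖ ^ 2 := by
  obtain ⟨z, _, hz⟩ := (isCompact_closedBall q (1 : ℝ)).exists_isMaxOn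
    ⟨q, mem_closedBall_self zero_le_one⟩
    (f := fun z => Φ z - β * ‖z - q‖ ^ 2) (by fun_prop)
  have hq' : ‖z₀ - q‖ ^ 2 ≤ 1 / 4 := by
    rw [norm_sub_rev]; nlinarith [norm_nonneg (q - z₀)]
  have hz0 : Φ z₀ - β * ‖z₀ - q‖ ^ 2 ≤ Φ z - β * ‖z - q‖ ^ 2 :=
    hz (by rw [mem_closedBall, dist_eq_norm, norm_sub_rev]; linarith)
  have h1 : Φ z₀ - β / 4 ≤ Φ z - β * ‖z - q‖ ^ 2 := by nlinarith
  have h2 := hz₀ z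
  have h3 : ‖z - q‖ ^ 2 ≤ 3 / 4 := by
    by_contra! hcon
    nlinarith
  refine ⟨z, ⟨?_, fun y => ?_⟩, h1⟩
  · by_contra! hcon
    nlinarith
  · rcases le_or_gt ‖y - q‖ 1 with hy | hy
    · have h4 : Φ y - β * ‖y - q‖ ^ 2 ≤ Φ z - β * ‖z - q‖ ^ 2 :=
        hz (by rwa [mem_closedBall, dist_eq_norm])
      rw [min_eq_left (by nlinarith [norm_nonneg (y - q)])]
      linarith
    · rw [min_eq_right (by nlinarith)]
      have := hz₀ y
      nlinarith

section Semiconvex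

variable {c β : ℝ} {U W : E → ℝ} {g g' : E → E} {q z : E}

lemma IsTouching.slope_add_slope (hU : IsSemiconvexWith c U g) (hW : IsSemiconvexWith c W g')
    (hβ : 0 ≤ β) (h : IsTouching β (U + W) q z) : g z + g' z = (2 * β) • (z - q) := by
  rw [← sub_eq_zero]
  refine eq_zero_of_inner_le_mul_norm_sq (C := 2 * c + β) fun w => ?_
  have h1 := h.le_add_inner hβ (z + w)
  have h2 := hU z (z + w)
  have h3 := hW z (z + w)
  simp only [Pi.add_apply, add_sub_cancel_left] at h1 h2 h3
  rw [inner_sub_left, inner_add_left]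
  linarith

lemma IsTouching.le_paraboloid (hU : IsSemiconvexWith c U g) (hW : IsSemiconvexWith c W g')
    (hβ : 0 ≤ β) (h : IsTouching β (U + W) q z) (y : E) :
    U y ≤ U z + ⟪g z, y - z⟫ + (c + β) * ‖y - z‖ ^ 2 := by
  have h1 := h.le_add_inner hβ y
  rw [← h.slope_add_slope hU hW hβ, inner_add_left] at h1
  have h3 := hW z y
  simp only [Pi.add_apply] at h1
  linarith

/-- A version of Jensen's lemma combined with second-order differentiability: among the points
touched by truncated paraboloids there is one where both selections of slopes are
differentiable. -/
lemma exists_isTouching_differentiableAt [FiniteDimensional ℝ E]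
    (hU : IsSemiconvexWith c U g) (hW : IsSemiconvexWith c W g')
    (hc : 0 ≤ c) (hβ : 0 < β) (hcont : Continuous (U + W)) {z₀ : E}
    (hz₀ : ∀ z, (U + W) z ≤ (U + W) z₀ + β / 2) :
    ∃ q z, IsTouching β (U + W) q z ∧ (U + W) z₀ - β / 4 ≤ (U + W) z - β * ‖z - q‖ ^ 2 ∧
      DifferentiableAt ℝ g z ∧ DifferentiableAt ℝ g' z := by
  let _ : MeasurableSpace E := borel E
  have _ : BorelSpace E := ⟨rfl⟩
  set ν : Measure E := Measure.hausdorffMeasure (Module.finrank ℝ E) with hν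
  set K : Set E := {z | ∃ q, IsTouching β (U + W) q z ∧
    (U + W) z₀ - β / 4 ≤ (U + W) z - β * ‖z - q‖ ^ 2} with hK
  set Λ := 4 * (c + β) + 2 * c with hΛ
  have hgK : ∀ k ∈ K, ∀ z, ‖g z - g k‖ ≤ Λ * ‖z - k‖ := by
    rintro k ⟨q, hq, _⟩ z
    exact hU.norm_sub_le (by positivity) (hq.le_paraboloid hU hW hβ.le) z
  have hgK' : ∀ k ∈ K, ∀ z, ‖g' z - g' k‖ ≤ Λ * ‖z - k‖ := by
    rintro k ⟨q, hq, _⟩ z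
    rw [add_comm] at hq
    exact hW.norm_sub_le (by positivity) (hq.le_paraboloid hW hU hβ.le) z
  have hae := (ae_differentiableAt_of_lipschitz_at ν hgK).and
    (ae_differentiableAt_of_lipschitz_at ν hgK')
  set T : E → E := fun z => z - (1 / (2 * β)) • (g z + g' z) with hT
  have hTL : LipschitzOnWith (1 + 1 / (2 * β) * (2 * Λ)).toNNReal T K := by
    refine LipschitzOnWith.of_dist_le_mul fun x _ y hy => ?_
    rw [dist_eq_norm, dist_eq_norm, Real.coe_toNNReal _ (by positivity)]
    calc ‖T x - T y‖ = ‖(x - y) - (1 / (2 * β)) • ((g x - g y) + (g' x - g' y))‖ := by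
          congr 1; simp only [hT, smul_add, smul_sub]; abel
      _ ≤ ‖x - y‖ + 1 / (2 * β) * (Λ * ‖x - y‖ + Λ * ‖x - y‖) := by
          refine (norm_sub_le _ _).trans ?_
          rw [norm_smul, Real.norm_of_nonneg (by positivity)]
          gcongr
          exact (norm_add_le _ _).trans (add_le_add (hgK y hy x) (hgK' y hy x))
      _ = _ := by ring
  have hball : ball z₀ (1 / 2) ⊆ T '' K := by
    intro q hq
    rw [mem_ball, dist_eq_norm] at hq
    obtain ⟨z, hz, hz'⟩ := exists_isTouching hβ hcont hz₀ hq
    refine ⟨z, ⟨q, hz, hz'⟩, ?_⟩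
    simp only [hT]
    rw [hz.slope_add_slope hU hW hβ.le, smul_smul, one_div_mul_cancel (by positivity), one_smul,
      sub_sub_cancel]
  have hKpos : ν K ≠ 0 := by
    intro h0
    have h1 := hTL.hausdorffMeasure_image_le (d := Module.finrank ℝ E) (Nat.cast_nonneg _)
    rw [← hν, h0, mul_zero] at h1
    have h2 : ν (ball z₀ (1 / 2)) ≤ 0 := (measure_mono hball).trans h1
    exact (measure_ball_pos ν z₀ (by norm_num : (0 : ℝ) < 1 / 2)).not_ge h2
  by_contra! hcon
  refine hKpos (measure_mono_null (fun k hk => ?_) hae)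
  obtain ⟨q, hq, hq'⟩ := hk
  exact fun hd => hcon q k hq hq' (hd.1 ⟨q, hq, hq'⟩) (hd.2 ⟨q, hq, hq'⟩)

end Semiconvex

end TouchingPoint

section QuadraticForm

variable {d : ℕ}

lemma quadF_add (A B : Matrix (Fin d) (Fin d) ℝ) (h : EuclideanSpace ℝ (Fin d)) :
    quadF (A + B) h = quadF A h + quadF B h := by
  simp [quadF, inner_add_left]

lemma quadF_sub (A B : Matrix (Fin d) (Fin d) ℝ) (h : EuclideanSpace ℝ (Fin d)) :
    quadF (A - B) h = quadF A h - quadF B h := by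
  simp [quadF, inner_sub_left]

lemma quadF_neg (A : Matrix (Fin d) (Fin d) ℝ) (h : EuclideanSpace ℝ (Fin d)) :
    quadF (-A) h = -quadF A h := by
  simp [quadF]

lemma quadF_smul (c : ℝ) (A : Matrix (Fin d) (Fin d) ℝ) (h : EuclideanSpace ℝ (Fin d)) :
    quadF (c • A) h = c * quadF A h := by
  simp [quadF, inner_smul_left]

lemma toEuclideanLin_one_apply (h : EuclideanSpace ℝ (Fin d)) :
    Matrix.toEuclideanLin (1 : Matrix (Fin d) (Fin d) ℝ) h = h := by
  ext i
  simp

lemma toEuclideanLin_mul_apply (A B : Matrix (Fin d) (Fin d) ℝ) (h : EuclideanSpace ℝ (Fin d)) :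
    Matrix.toEuclideanLin (A * B) h = Matrix.toEuclideanLin A (Matrix.toEuclideanLin B h) := by
  ext i
  simp [Matrix.toLpLin_apply]

lemma quadF_one (h : EuclideanSpace ℝ (Fin d)) :
    quadF (1 : Matrix (Fin d) (Fin d) ℝ) h = ‖h‖ ^ 2 := by
  rw [quadF, toEuclideanLin_one_apply, real_inner_self_eq_norm_sq]

lemma inner_toEuclideanLin_transpose (A : Matrix (Fin d) (Fin d) ℝ)
    (x y : EuclideanSpace ℝ (Fin d)) :
    ⟪Matrix.toEuclideanLin A.transpose x, y⟫ = ⟪x, Matrix.toEuclideanLin A y⟫ := by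
  rw [← Matrix.conjTranspose_eq_transpose_of_trivial, Matrix.toEuclideanLin_conjTranspose_eq_adjoint,
    LinearMap.adjoint_inner_left]

lemma inner_toEuclideanLin_of_isSymm {A : Matrix (Fin d) (Fin d) ℝ} (hA : A.IsSymm)
    (x y : EuclideanSpace ℝ (Fin d)) :
    ⟪Matrix.toEuclideanLin A x, y⟫ = ⟪x, Matrix.toEuclideanLin A y⟫ := by
  conv_lhs => rw [← hA.eq]
  exact inner_toEuclideanLin_transpose A x y

lemma exists_isSymm_quadF_eq
    (A : EuclideanSpace ℝ (Fin d) →L[ℝ] EuclideanSpace ℝ (Fin d)) :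
    ∃ Z : Matrix (Fin d) (Fin d) ℝ, Z.IsSymm ∧ ∀ h, quadF Z h = ⟪A h, h⟫ := by
  set N := Matrix.toEuclideanLin.symm (A : EuclideanSpace ℝ (Fin d) →ₗ[ℝ] EuclideanSpace ℝ (Fin d))
    with hN
  have hNA : ∀ h, Matrix.toEuclideanLin N h = A h := by simp [hN]
  refine ⟨(1 / 2 : ℝ) • (N + N.transpose), ?_, fun h => ?_⟩
  · rw [Matrix.IsSymm, Matrix.transpose_smul, Matrix.transpose_add, Matrix.transpose_transpose,
      add_comm]
  · rw [quadF_smul, quadF_add, quadF, quadF, inner_toEuclideanLin_transpose, hNA,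
      real_inner_comm h (A h)]
    ring

lemma quadF_add_vec {A : Matrix (Fin d) (Fin d) ℝ} (hA : A.IsSymm)
    (x y : EuclideanSpace ℝ (Fin d)) :
    quadF A (x + y) = quadF A x + 2 * ⟪Matrix.toEuclideanLin A x, y⟫ + quadF A y := by
  simp only [quadF, map_add, inner_add_left, inner_add_right]
  rw [inner_toEuclideanLin_of_isSymm hA y x, real_inner_comm (Matrix.toEuclideanLin A x) y]
  ring

lemma inner_toEuclideanLin_single (A : Matrix (Fin d) (Fin d) ℝ) (i k : Fin d) :
    ⟪Matrix.toEuclideanLin A (EuclideanSpace.single i 1), EuclideanSpace.single k (1 : ℝ)⟫ =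
      A k i := by
  simp [Matrix.toLpLin_apply, EuclideanSpace.inner_single_right]

lemma abs_entry_le_of_abs_quadF_le {A : Matrix (Fin d) (Fin d) ℝ} (hA : A.IsSymm) {C : ℝ}
    (hC : 0 ≤ C) (h : ∀ x, |quadF A x| ≤ C * ‖x‖ ^ 2) (i k : Fin d) : |A i k| ≤ 3 * C := by
  set ei := EuclideanSpace.single i (1 : ℝ)
  set ek := EuclideanSpace.single k (1 : ℝ)
  have hi : ‖ei‖ = 1 := by simp [ei]
  have hk : ‖ek‖ = 1 := by simp [ek]
  have hik : ‖ei + ek‖ ≤ 2 := (norm_add_le _ _).trans (by rw [hi, hk]; norm_num)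
  have h1 := quadF_add_vec hA ei ek
  rw [inner_toEuclideanLin_single, hA.apply] at h1
  have h2 := abs_le.1 (h ei)
  have h3 := abs_le.1 (h ek)
  have h4 := abs_le.1 (h (ei + ek))
  have h5 : C * ‖ei + ek‖ ^ 2 ≤ 4 * C := by
    have : ‖ei + ek‖ ^ 2 ≤ 4 := by nlinarith [norm_nonneg (ei + ek)]
    nlinarith
  rw [hi] at h2
  rw [hk] at h3
  rw [abs_le]
  constructor <;> linarith

lemma posSemidef_of_quadF_nonneg {A : Matrix (Fin d) (Fin d) ℝ} (hA : A.IsSymm)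
    (h : ∀ x, 0 ≤ quadF A x) : A.PosSemidef := by
  rw [← Matrix.isPositive_toEuclideanLin_iff, LinearMap.isPositive_iff]
  exact ⟨fun x y => inner_toEuclideanLin_of_isSymm hA x y, h⟩

/-- The matrix `X = Z (I + sZ)⁻¹`: its quadratic form is the infimal convolution of that of `Z`
with `‖·‖² / s`. -/
lemma exists_parallel_sum {Z : Matrix (Fin d) (Fin d) ℝ} (hZ : Z.IsSymm) {s τ : ℝ} (hs : 0 < s)
    (hτ : 0 < τ) (hlow : ∀ h, (-(1 / s) + τ) * ‖h‖ ^ 2 ≤ quadF Z h) :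
    ∃ (X : Matrix (Fin d) (Fin d) ℝ)
      (B : EuclideanSpace ℝ (Fin d) →ₗ[ℝ] EuclideanSpace ℝ (Fin d)), X.IsSymm ∧
      (∀ ξ η, quadF X ξ - quadF Z η ≤ 1 / s * ‖ξ - η‖ ^ 2) ∧
      ∀ ξ, quadF X ξ = quadF Z (B ξ) + 1 / s * ‖ξ - B ξ‖ ^ 2 := by
  set P : Matrix (Fin d) (Fin d) ℝ := 1 + s • Z with hP
  have hquadP : ∀ h, quadF P h = ‖h‖ ^ 2 + s * quadF Z h := fun h => by
    rw [hP, quadF_add, quadF_one, quadF_smul]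
  have hPpos : ∀ h, s * τ * ‖h‖ ^ 2 ≤ quadF P h := fun h => by
    have h1 := mul_le_mul_of_nonneg_left (hlow h) hs.le
    have h2 : s * ((-(1 / s) + τ) * ‖h‖ ^ 2) = -‖h‖ ^ 2 + s * τ * ‖h‖ ^ 2 := by field_simp
    rw [hquadP]
    linarith
  have hinj : Function.Injective (Matrix.toEuclideanLin P) := by
    rw [← LinearMap.ker_eq_bot, LinearMap.ker_eq_bot']
    intro h hh
    have h1 := hPpos h
    rw [quadF, hh, inner_zero_left] at h1
    have h2 : 0 < s * τ := mul_pos hs hτ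
    have h3 : ‖h‖ ^ 2 ≤ 0 := by
      by_contra! hcon
      have := mul_pos h2 hcon
      linarith
    exact norm_eq_zero.1 (by nlinarith [norm_nonneg h])
  have hdet : IsUnit P.det := by
    rw [← Matrix.isUnit_iff_isUnit_det, ← Matrix.mulVec_injective_iff_isUnit]
    intro a b hab
    have : Matrix.toEuclideanLin P (WithLp.toLp 2 a) = Matrix.toEuclideanLin P (WithLp.toLp 2 b) := by
      simp only [Matrix.toLpLin_toLp, Matrix.toLin'_apply]
      rw [hab]
    simpa using hinj this
  have hPsymm : P.IsSymm := by
    rw [hP, Matrix.IsSymm, Matrix.transpose_add, Matrix.transpose_smul, hZ.eq, Matrix.transpose_one]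
  have hcomm : Z * P = P * Z := by
    rw [hP, mul_add, add_mul]
    simp
  have hXsymm : (Z * P⁻¹).IsSymm := by
    rw [Matrix.IsSymm, Matrix.transpose_mul, Matrix.transpose_nonsing_inv, hPsymm.eq, hZ.eq]
    calc P⁻¹ * Z = P⁻¹ * (Z * P) * P⁻¹ := by
          rw [mul_assoc, mul_assoc, Matrix.mul_nonsing_inv _ hdet, mul_one]
      _ = Z * P⁻¹ := by rw [hcomm, ← mul_assoc, Matrix.nonsing_inv_mul _ hdet, one_mul]
  have hdecomp : ∀ ξ, ξ = Matrix.toEuclideanLin P⁻¹ ξ +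
      s • Matrix.toEuclideanLin Z (Matrix.toEuclideanLin P⁻¹ ξ) := by
    intro ξ
    have : Matrix.toEuclideanLin P (Matrix.toEuclideanLin P⁻¹ ξ) = ξ := by
      rw [← toEuclideanLin_mul_apply, Matrix.mul_nonsing_inv _ hdet, toEuclideanLin_one_apply]
    rw [hP, map_add, LinearMap.add_apply, toEuclideanLin_one_apply, map_smul,
      LinearMap.smul_apply, ← hP] at this
    exact this.symm
  have hX : ∀ ξ, quadF (Z * P⁻¹) ξ = quadF Z (Matrix.toEuclideanLin P⁻¹ ξ) +
      1 / s * ‖ξ - Matrix.toEuclideanLin P⁻¹ ξ‖ ^ 2 := by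
    intro ξ
    have h1 := hdecomp ξ
    rw [quadF, toEuclideanLin_mul_apply]
    set η := Matrix.toEuclideanLin P⁻¹ ξ
    rw [quadF, h1, add_sub_cancel_left, inner_add_right, inner_smul_right, norm_smul,
      real_inner_self_eq_norm_sq, Real.norm_of_nonneg hs.le]
    field_simp
  refine ⟨Z * P⁻¹, Matrix.toEuclideanLin P⁻¹, hXsymm, fun ξ η => ?_, hX⟩
  rw [hX]
  have h1 := hdecomp ξ
  set b := Matrix.toEuclideanLin P⁻¹ ξ
  obtain ⟨e, rfl⟩ : ∃ e, η = b + e := ⟨η - b, by abel⟩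
  have h2 : ξ - b = s • Matrix.toEuclideanLin Z b := by
    rw [sub_eq_iff_eq_add']; exact h1
  have h3 : ξ - (b + e) = s • Matrix.toEuclideanLin Z b - e := by rw [← h2]; abel
  rw [quadF_add_vec hZ, h2, h3, norm_sub_sq_real, inner_smul_left]
  have h4 := hlow e
  have h5 : 0 ≤ τ * ‖e‖ ^ 2 := by positivity
  simp only [conj_trivial]
  have h6 : 1 / s * (‖s • Matrix.toEuclideanLin Z b‖ ^ 2 -
      2 * (s * ⟪Matrix.toEuclideanLin Z b, e⟫) + ‖e‖ ^ 2) =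
      1 / s * ‖s • Matrix.toEuclideanLin Z b‖ ^ 2 - 2 * ⟪Matrix.toEuclideanLin Z b, e⟫ +
        1 / s * ‖e‖ ^ 2 := by
    field_simp
  rw [h6]
  nlinarith

end QuadraticForm

section TestFunction

variable {d : ℕ}

/-- The quadratic polynomial with value `c`, gradient `p` and Hessian `X` at `x`. -/
noncomputable def quadPoly (c : ℝ) (x p : EuclideanSpace ℝ (Fin d))
    (X : Matrix (Fin d) (Fin d) ℝ) (y : EuclideanSpace ℝ (Fin d)) : ℝ :=
  c + ⟪p, y - x⟫ + 1 / 2 * quadF X (y - x)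

lemma hasFDerivAt_quadPoly {X : Matrix (Fin d) (Fin d) ℝ} (hX : X.IsSymm) (c : ℝ)
    (x p y : EuclideanSpace ℝ (Fin d)) :
    HasFDerivAt (quadPoly c x p X)
      (innerSL ℝ (p + (Matrix.toEuclideanLin X).toContinuousLinearMap (y - x))) y := by
  set T := (Matrix.toEuclideanLin X).toContinuousLinearMap with hT
  have hsub : HasFDerivAt (fun y : EuclideanSpace ℝ (Fin d) => y - x)
      (ContinuousLinearMap.id ℝ _) y := (hasFDerivAt_id y).sub_const x
  have h1 := (hasFDerivAt_const p y).inner ℝ hsub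
  have h2 := (T.hasFDerivAt.comp y hsub).inner ℝ hsub
  refine ((h1.const_add c).add (h2.const_mul (1 / 2))).congr_fderiv ?_
  ext h
  have h3 : ⟪T h, y - x⟫ = ⟪T (y - x), h⟫ := by
    rw [real_inner_comm]
    exact (inner_toEuclideanLin_of_isSymm hX (y - x) h).symm
  simp [h3, inner_sub_left]
  ring

lemma contDiff_quadPoly {X : Matrix (Fin d) (Fin d) ℝ} (c : ℝ) (x p : EuclideanSpace ℝ (Fin d))
    {n : WithTop ℕ∞} : ContDiff ℝ n (quadPoly c x p X) := by
  have hT : ContDiff ℝ n fun y : EuclideanSpace ℝ (Fin d) => Matrix.toEuclideanLin X (y - x) :=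
    (Matrix.toEuclideanLin X).toContinuousLinearMap.contDiff.comp (contDiff_id.sub contDiff_const)
  have hsub : ContDiff ℝ n fun y : EuclideanSpace ℝ (Fin d) => y - x :=
    contDiff_id.sub contDiff_const
  exact (contDiff_const.add (contDiff_const.inner ℝ hsub)).add
    (contDiff_const.mul (hT.inner ℝ hsub))

lemma gradient_quadPoly {X : Matrix (Fin d) (Fin d) ℝ} (hX : X.IsSymm) (c : ℝ)
    (x p : EuclideanSpace ℝ (Fin d)) : gradient (quadPoly c x p X) x = p := by
  refine HasGradientAt.gradient ?_
  rw [hasGradientAt_iff_hasFDerivAt]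
  refine (hasFDerivAt_quadPoly hX c x p x).congr_fderiv ?_
  ext h
  simp

lemma hessM_quadPoly {X : Matrix (Fin d) (Fin d) ℝ} (hX : X.IsSymm) (c : ℝ)
    (x p : EuclideanSpace ℝ (Fin d)) : hessM (quadPoly c x p X) x = X := by
  set T := (Matrix.toEuclideanLin X).toContinuousLinearMap with hT
  have h1 : fderiv ℝ (quadPoly c x p X) = fun y => innerSL ℝ (p + T (y - x)) :=
    funext fun y => (hasFDerivAt_quadPoly hX c x p y).fderiv
  have hsub : HasFDerivAt (fun y : EuclideanSpace ℝ (Fin d) => y - x)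
      (ContinuousLinearMap.id ℝ _) x := (hasFDerivAt_id x).sub_const x
  have h2 := (innerSL ℝ (E := EuclideanSpace ℝ (Fin d))).hasFDerivAt.comp x
    ((T.hasFDerivAt.comp x hsub).const_add p)
  ext i k
  rw [hessM, Matrix.of_apply, iteratedFDeriv_two_apply, h1]
  erw [h2.fderiv]
  have := inner_toEuclideanLin_single X i k
  rw [hX.apply] at this
  exact this

lemma hessM_congr {φ ψ : EuclideanSpace ℝ (Fin d) → ℝ} {x : EuclideanSpace ℝ (Fin d)}
    (h : φ =ᶠ[𝓝 x] ψ) : hessM φ x = hessM ψ x := by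
  rw [hessM, hessM, (h.iteratedFDeriv ℝ 2).eq_of_nhds]

lemma gradient_fun_neg (φ : EuclideanSpace ℝ (Fin d) → ℝ) (x : EuclideanSpace ℝ (Fin d)) :
    gradient (fun y => -φ y) x = -gradient φ x := by
  simp [gradient, fderiv_fun_neg]

lemma hessM_fun_neg (φ : EuclideanSpace ℝ (Fin d) → ℝ) (x : EuclideanSpace ℝ (Fin d)) :
    hessM (fun y => -φ y) x = -hessM φ x := by
  ext i k
  have : iteratedFDeriv ℝ 2 (fun y => -φ y) x = -iteratedFDeriv ℝ 2 φ x :=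
    iteratedFDeriv_neg_apply
  simp [hessM, this]

lemma abs_quadF_le (X : Matrix (Fin d) (Fin d) ℝ) (h : EuclideanSpace ℝ (Fin d)) :
    |quadF X h| ≤ ‖(Matrix.toEuclideanLin X).toContinuousLinearMap‖ * ‖h‖ ^ 2 := by
  refine (abs_real_inner_le_norm _ _).trans ?_
  rw [pow_two, ← mul_assoc]
  exact mul_le_mul_of_nonneg_right
    ((Matrix.toEuclideanLin X).toContinuousLinearMap.le_opNorm h) (norm_nonneg h)

/-- A smooth majorant of `u` that agrees with a given quadratic polynomial near `x` and, away from
`x`, stays below a given continuous strict majorant `S`. -/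
lemma exists_contDiff_between {u S P Q : EuclideanSpace ℝ (Fin d) → ℝ}
    (hu : UpperSemicontinuous u) (hS : Continuous S) (hP : Continuous P) (hQ : ContDiff ℝ 2 Q)
    {x : EuclideanSpace ℝ (Fin d)} {ρ K : ℝ} (hρ : 0 < ρ) (huS : ∀ y, u y < S y)
    (huP : ∀ y, y ≠ x → u y < P y) (huK : ∀ y, u y < K)
    (huQ : ∀ y, ‖y - x‖ < ρ → u y ≤ Q y) (hQP : ∀ y, Q y ≤ P y)
    (hQK : ∀ y, ‖y - x‖ < ρ → Q y ≤ K) :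
    ∃ φ : EuclideanSpace ℝ (Fin d) → ℝ, ContDiff ℝ 2 φ ∧ (∀ y, u y ≤ φ y) ∧ φ =ᶠ[𝓝 x] Q ∧
      (∀ y, φ y ≤ P y) ∧ (∀ y, φ y ≤ K) ∧ ∀ y, ρ ≤ ‖y - x‖ → φ y ≤ S y := by
  set t : EuclideanSpace ℝ (Fin d) → Set ℝ := fun y => {a | u y ≤ a ∧ a ≤ P y ∧ a ≤ K ∧
    (ρ ≤ ‖y - x‖ → a ≤ S y) ∧ (‖y - x‖ ≤ ρ / 2 → a = Q y)} with ht
  have htconv : ∀ y, Convex ℝ (t y) := fun y => by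
    refine Set.OrdConnected.convex ⟨?_⟩
    rintro a ⟨ha1, -, -, -, ha5⟩ b ⟨-, hb2, hb3, hb4, hb5⟩ c ⟨hac, hcb⟩
    refine ⟨ha1.trans hac, hcb.trans hb2, hcb.trans hb3, fun h => hcb.trans (hb4 h), fun h => ?_⟩
    exact le_antisymm (hcb.trans (hb5 h).le) ((ha5 h).ge.trans hac)
  have hcn : Continuous fun y : EuclideanSpace ℝ (Fin d) => ‖y - x‖ := by fun_prop
  obtain ⟨φ, hφ⟩ := exists_contMDiffMap_forall_mem_convex_of_local (n := 2) (t := t)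
    (modelWithCornersSelf ℝ (EuclideanSpace ℝ (Fin d))) htconv (fun y => by
      rcases lt_or_ge ‖y - x‖ ρ with h | h
      · refine ⟨{y | ‖y - x‖ < ρ}, (isOpen_lt hcn continuous_const).mem_nhds h, Q,
          hQ.contMDiff.contMDiffOn, fun z hz => ⟨huQ z hz, hQP z, hQK z hz, fun h' => ?_,
          fun _ => rfl⟩⟩
        exact absurd hz (not_lt.2 h')
      · have hyx : y ≠ x := by
          rintro rfl
          rw [sub_self, norm_zero] at h
          linarith
        obtain ⟨c, hc1, hc2⟩ := exists_between (lt_min (lt_min (huP y hyx) (huS y)) (huK y))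
        simp only [lt_min_iff] at hc2
        have hopen : IsOpen {y : EuclideanSpace ℝ (Fin d) | ρ / 2 < ‖y - x‖} :=
          isOpen_lt continuous_const hcn
        refine ⟨_, inter_mem (inter_mem (hu y c hc1) ((isOpen_lt continuous_const hP).mem_nhds
          hc2.1.1)) (inter_mem ((isOpen_lt continuous_const hS).mem_nhds hc2.1.2)
          (hopen.mem_nhds (by change ρ / 2 < ‖y - x‖; linarith))), fun _ => c,
          contMDiffOn_const, ?_⟩
        rintro z ⟨⟨hz1, hz2⟩, hz3, hz4⟩
        exact ⟨le_of_lt hz1, le_of_lt hz2, hc2.2.le, fun _ => le_of_lt hz3,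
          fun h => absurd hz4 (not_lt.2 h)⟩)
  refine ⟨φ, φ.contMDiff.contDiff, fun y => (hφ y).1, ?_, fun y => (hφ y).2.1,
    fun y => (hφ y).2.2.1, fun y => (hφ y).2.2.2.1⟩
  filter_upwards [(isOpen_lt hcn continuous_const).mem_nhds
    (show ‖x - x‖ < ρ / 2 by rw [sub_self, norm_zero]; linarith)] with y hy
  exact (hφ y).2.2.2.2 (le_of_lt hy)

/-- A bounded sequence of `C²` majorants of `u` that converges pointwise to `u` and whose members
coincide near `x` with the quadratic polynomial with jet `(u x, p, X)` at `x`. -/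
structure IsTestSeq (u : EuclideanSpace ℝ (Fin d) → ℝ) (x p : EuclideanSpace ℝ (Fin d))
    (X : Matrix (Fin d) (Fin d) ℝ) (φ : ℕ → EuclideanSpace ℝ (Fin d) → ℝ) : Prop where
  contDiff : ∀ n, ContDiff ℝ 2 (φ n)
  le : ∀ n y, u y ≤ φ n y
  eventuallyEq : ∀ n, φ n =ᶠ[𝓝 x] quadPoly (u x) x p X
  le_quadratic : ∃ C, ∀ n y, φ n y ≤ u x + ⟪p, y - x⟫ + C * ‖y - x‖ ^ 2
  bounded : ∃ K, ∀ n y, |φ n y| ≤ K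
  tendsto : ∀ y, Tendsto (fun n => φ n y) atTop (𝓝 (u y))

namespace IsTestSeq

variable {u : EuclideanSpace ℝ (Fin d) → ℝ} {x p : EuclideanSpace ℝ (Fin d)}
  {X : Matrix (Fin d) (Fin d) ℝ} {φ : ℕ → EuclideanSpace ℝ (Fin d) → ℝ}

lemma apply_self (h : IsTestSeq u x p X φ) (n : ℕ) : φ n x = u x := by
  rw [(h.eventuallyEq n).eq_of_nhds]
  simp [quadPoly, quadF]

lemma gradient_eq (h : IsTestSeq u x p X φ) (hX : X.IsSymm) (n : ℕ) :
    gradient (φ n) x = p := by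
  rw [(h.eventuallyEq n).gradient_eq, gradient_quadPoly hX]

lemma hessM_eq (h : IsTestSeq u x p X φ) (hX : X.IsSymm) (n : ℕ) : hessM (φ n) x = X := by
  rw [hessM_congr (h.eventuallyEq n), hessM_quadPoly hX]

lemma exists_abs_sub_le (h : IsTestSeq u x p X φ) (n : ℕ) :
    ∃ C, 0 ≤ C ∧ ∀ y, |φ n y - u x - ⟪p, y - x⟫| ≤ C * ‖y - x‖ ^ 2 := by
  obtain ⟨r, hr, hball⟩ := Metric.eventually_nhds_iff.1 (h.eventuallyEq n)
  obtain ⟨K, hK⟩ := h.bounded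
  have hK0 : 0 ≤ K := (abs_nonneg _).trans (hK n x)
  set T := ‖(Matrix.toEuclideanLin X).toContinuousLinearMap‖
  have hT0 : 0 ≤ T := norm_nonneg _
  refine ⟨T + 2 * K / r ^ 2 + ‖p‖ / r, by positivity, fun y => ?_⟩
  have hC : (T + 2 * K / r ^ 2 + ‖p‖ / r) * ‖y - x‖ ^ 2 = T * ‖y - x‖ ^ 2 +
      2 * K * (‖y - x‖ ^ 2 / r ^ 2) + ‖p‖ * (‖y - x‖ ^ 2 / r) := by ring
  rw [hC]
  rcases lt_or_ge ‖y - x‖ r with hy | hy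
  · have h1 := abs_quadF_le X (y - x)
    rw [hball (by rwa [dist_eq_norm]), quadPoly, show u x + ⟪p, y - x⟫ + 1 / 2 * quadF X (y - x) -
      u x - ⟪p, y - x⟫ = 1 / 2 * quadF X (y - x) by ring, abs_mul, abs_of_pos (by norm_num)]
    have h2 : 0 ≤ 2 * K * (‖y - x‖ ^ 2 / r ^ 2) + ‖p‖ * (‖y - x‖ ^ 2 / r) := by positivity
    linarith [abs_nonneg (quadF X (y - x))]
  · have h1 := abs_real_inner_le_norm p (y - x)
    have h2 := hK n y
    have h3 := hK n x
    rw [h.apply_self] at h3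
    have h4 : 1 ≤ ‖y - x‖ ^ 2 / r ^ 2 := by
      rw [one_le_div (by positivity)]
      gcongr
    have h5 : ‖y - x‖ ≤ ‖y - x‖ ^ 2 / r := by
      rw [le_div_iff₀ hr]
      nlinarith
    have h7 := mul_le_mul_of_nonneg_left h4 (by positivity : 0 ≤ 2 * K)
    have h8 := mul_le_mul_of_nonneg_left h5 (norm_nonneg p)
    have h9 : 0 ≤ T * ‖y - x‖ ^ 2 := by positivity
    have h10 := abs_sub (φ n y - u x) ⟪p, y - x⟫
    have h11 := abs_sub (φ n y) (u x)
    linarith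

end IsTestSeq

lemma exists_isTestSeq {u : EuclideanSpace ℝ (Fin d) → ℝ} (hu : UpperSemicontinuous u)
    {M : ℝ} (hM : ∀ y, |u y| ≤ M) {x p : EuclideanSpace ℝ (Fin d)}
    {X : Matrix (Fin d) (Fin d) ℝ} {r : ℝ} (hr : 0 < r)
    (hux : ∀ y, ‖y - x‖ < r → u y ≤ quadPoly (u x) x p X y) :
    ∃ φ, IsTestSeq u x p X φ := by
  set T := ‖(Matrix.toEuclideanLin X).toContinuousLinearMap‖
  have hT0 : 0 ≤ T := norm_nonneg _
  have hM0 : 0 ≤ M := (abs_nonneg _).trans (hM x)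
  have hQT : ∀ y, quadPoly (u x) x p X y ≤ u x + ⟪p, y - x⟫ + T * ‖y - x‖ ^ 2 := fun y => by
    have h1 := (abs_le.1 (abs_quadF_le X (y - x))).2
    have h2 : 0 ≤ T * ‖y - x‖ ^ 2 := by positivity
    unfold quadPoly
    linarith
  set C := T + 2 * M / r ^ 2 + ‖p‖ / r + 1 with hC
  have hTC : T < C := by
    have : 0 ≤ 2 * M / r ^ 2 + ‖p‖ / r := by positivity
    linarith
  set K := M + ‖p‖ * r + T * r ^ 2 + 1 with hK
  have hQC : ∀ y, quadPoly (u x) x p X y ≤ u x + ⟪p, y - x⟫ + C * ‖y - x‖ ^ 2 := fun y => by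
    have := mul_le_mul_of_nonneg_right hTC.le (sq_nonneg ‖y - x‖)
    linarith [hQT y]
  have huC : ∀ y, y ≠ x → u y < u x + ⟪p, y - x⟫ + C * ‖y - x‖ ^ 2 := fun y hy => by
    have hpos : 0 < ‖y - x‖ := norm_pos_iff.2 (sub_ne_zero.2 hy)
    rcases lt_or_ge ‖y - x‖ r with h | h
    · have := mul_lt_mul_of_pos_right hTC (pow_pos hpos 2)
      linarith [hux y h, hQT y]
    · have h1 := (abs_le.1 (abs_real_inner_le_norm p (y - x))).1
      have h2 := (abs_le.1 (hM x)).1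
      have h3 := (abs_le.1 (hM y)).2
      have h4 : 1 ≤ ‖y - x‖ ^ 2 / r ^ 2 := by
        rw [one_le_div (by positivity)]
        gcongr
      have h5 : ‖y - x‖ ≤ ‖y - x‖ ^ 2 / r := by
        rw [le_div_iff₀ hr]
        nlinarith
      have h6 : C * ‖y - x‖ ^ 2 = T * ‖y - x‖ ^ 2 + 2 * M * (‖y - x‖ ^ 2 / r ^ 2) +
          ‖p‖ * (‖y - x‖ ^ 2 / r) + ‖y - x‖ ^ 2 := by
        rw [hC]
        ring
      have h7 := mul_le_mul_of_nonneg_left h4 (by positivity : 0 ≤ 2 * M)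
      have h8 := mul_le_mul_of_nonneg_left h5 (norm_nonneg p)
      have h9 : 0 ≤ T * ‖y - x‖ ^ 2 := by positivity
      have h10 : 0 < ‖y - x‖ ^ 2 := by positivity
      linarith
  have hQK : ∀ y, ‖y - x‖ < r → quadPoly (u x) x p X y ≤ K := fun y hy => by
    have h1 := (abs_le.1 (abs_real_inner_le_norm p (y - x))).2
    have h2 := (abs_le.1 (hM x)).2
    have h3 : ‖p‖ * ‖y - x‖ ≤ ‖p‖ * r := by gcongr
    have h4 : T * ‖y - x‖ ^ 2 ≤ T * r ^ 2 := by gcongr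
    linarith [hQT y]
  have hpos : ∀ n : ℕ, 0 < 1 / ((n : ℝ) + 1) := fun n => by positivity
  have key : ∀ n : ℕ, ∃ φ : EuclideanSpace ℝ (Fin d) → ℝ, ContDiff ℝ 2 φ ∧ (∀ y, u y ≤ φ y) ∧
      φ =ᶠ[𝓝 x] quadPoly (u x) x p X ∧
      (∀ y, φ y ≤ u x + ⟪p, y - x⟫ + C * ‖y - x‖ ^ 2) ∧ (∀ y, φ y ≤ K) ∧
      ∀ y, min r (1 / ((n : ℝ) + 1)) ≤ ‖y - x‖ →
        φ y ≤ supConv u (1 / ((n : ℝ) + 1)) y + 1 / ((n : ℝ) + 1) := fun n => by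
    refine exists_contDiff_between hu ((continuous_supConv hu hM (hpos n)).add continuous_const)
      (by fun_prop) (contDiff_quadPoly _ _ _) (lt_min hr (hpos n)) (fun y => ?_) huC
      (fun y => ?_) (fun y hy => hux y (hy.trans_le (min_le_left _ _))) hQC
      (fun y hy => hQK y (hy.trans_le (min_le_left _ _)))
    · change u y < supConv u (1 / ((n : ℝ) + 1)) y + 1 / ((n : ℝ) + 1)
      linarith [self_le_supConv hM (hpos n) y, hpos n]
    · have : 0 ≤ ‖p‖ * r + T * r ^ 2 := by positivity
      linarith [(abs_le.1 (hM y)).2]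
  choose φ h1 h2 h3 h4 h5 h6 using key
  refine ⟨φ, h1, h2, h3, ⟨C, h4⟩, ⟨max K M, fun n y => abs_le.2 ⟨?_, ?_⟩⟩, fun y => ?_⟩
  · linarith [(abs_le.1 (hM y)).1, h2 n y, le_max_right K M]
  · exact (h5 n y).trans (le_max_left _ _)
  · rcases eq_or_ne y x with rfl | hy
    · have : ∀ n, φ n y = u y := fun n => by
        rw [(h3 n).eq_of_nhds]
        simp [quadPoly, quadF]
      simp only [this]
      exact tendsto_const_nhds
    · have hlim : Tendsto (fun n : ℕ => 1 / ((n : ℝ) + 1)) atTop (𝓝 0) :=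
        tendsto_one_div_add_atTop_nhds_zero_nat
      have hup : Tendsto (fun n : ℕ => supConv u (1 / ((n : ℝ) + 1)) y + 1 / ((n : ℝ) + 1)) atTop
          (𝓝 (u y)) := by
        simpa using (tendsto_supConv hu hM y).add hlim
      refine tendsto_of_tendsto_of_tendsto_of_le_of_le' tendsto_const_nhds hup
        (Eventually.of_forall fun n => h2 n y) ?_
      filter_upwards [hlim.eventually_lt_const (norm_pos_iff.2 (sub_ne_zero.2 hy))] with n hn
      exact h6 n y ((min_le_right _ _).trans hn.le)

end TestFunction

section Nonlocal

lemma integrable_of_lintegral_le {α : Type*} [MeasurableSpace α] {μ : Measure α} {f : α → ℝ}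
    (hf : AEStronglyMeasurable f μ) (h0 : ∀ z, 0 ≤ f z) {C : ℝ}
    (h : ∫⁻ z, ENNReal.ofReal (f z) ∂μ ≤ ENNReal.ofReal C) : Integrable f μ :=
  ⟨hf, (hasFiniteIntegral_iff_ofReal (Eventually.of_forall h0)).2
    (h.trans_lt ENNReal.ofReal_lt_top)⟩

lemma integral_le_of_lintegral_le {α : Type*} [MeasurableSpace α] {μ : Measure α} {f : α → ℝ}
    (hf : AEStronglyMeasurable f μ) (h0 : ∀ z, 0 ≤ f z) {C : ℝ} (hC : 0 ≤ C)
    (h : ∫⁻ z, ENNReal.ofReal (f z) ∂μ ≤ ENNReal.ofReal C) : ∫ z, f z ∂μ ≤ C := by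
  rw [integral_eq_lintegral_of_nonneg_ae (Eventually.of_forall h0) hf]
  exact ENNReal.toReal_le_of_le_ofReal hC h

/-- A one-sided dominated convergence theorem. -/
lemma exists_integral_le_add {α : Type*} [MeasurableSpace α] {μ : Measure α} {D : ℕ → α → ℝ}
    {D₀ G H : α → ℝ} (hD : ∀ n, Integrable (D n) μ) (hG : Integrable G μ) (hH : Integrable H μ)
    (hDG : ∀ n z, D n z ≤ G z) (hlim : ∀ z, Tendsto (fun n => D n z) atTop (𝓝 (D₀ z)))
    (hD₀ : ∀ z, D₀ z ≤ H z) {σ : ℝ} (hσ : 0 < σ) : ∃ n, ∫ z, D n z ∂μ ≤ ∫ z, H z ∂μ + σ := by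
  have hmax : ∀ n, Integrable (fun z => max (D n z) (H z)) μ := fun n => (hD n).sup hH
  have h1 : Tendsto (fun n => ∫ z, max (D n z) (H z) ∂μ) atTop (𝓝 (∫ z, H z ∂μ)) := by
    refine tendsto_integral_of_dominated_convergence (fun z => |G z| + |H z|)
      (fun n => (hmax n).aestronglyMeasurable) (hG.abs.add hH.abs)
      (fun n => Eventually.of_forall fun z => ?_) (Eventually.of_forall fun z => ?_)
    · rw [Real.norm_eq_abs, abs_le]
      constructor
      · linarith [le_max_right (D n z) (H z), neg_abs_le (H z), abs_nonneg (G z)]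
      · exact max_le (by linarith [hDG n z, le_abs_self (G z), abs_nonneg (H z)])
          (by linarith [le_abs_self (H z), abs_nonneg (G z)])
    · have := (hlim z).max (tendsto_const_nhds (x := H z))
      rwa [max_eq_right (hD₀ z)] at this
  obtain ⟨n, hn⟩ := (h1.eventually_lt_const (lt_add_of_pos_right _ hσ)).exists
  exact ⟨n, (integral_mono (hD n) (hmax n) fun z => le_max_left _ _).trans hn.le⟩

variable {d : ℕ} {μ : Measure (EuclideanSpace ℝ (Fin d))} {cb : ℝ}
  {j : EuclideanSpace ℝ (Fin d) → EuclideanSpace ℝ (Fin d) → EuclideanSpace ℝ (Fin d)}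

/-- The integrand of the Lévy–Itô operator, with a prescribed gradient `p`. -/
noncomputable def jumpIncrement (φ : EuclideanSpace ℝ (Fin d) → ℝ)
    (x p a z : EuclideanSpace ℝ (Fin d)) : ℝ :=
  φ (x + a) - φ x - ⟪p, a⟫ * (closedBall (0 : EuclideanSpace ℝ (Fin d)) 1).indicator
    (fun _ => (1 : ℝ)) z

lemma jumpIncrement_of_norm_le {φ : EuclideanSpace ℝ (Fin d) → ℝ}
    {x p a z : EuclideanSpace ℝ (Fin d)} (hz : ‖z‖ ≤ 1) :
    jumpIncrement φ x p a z = φ (x + a) - φ x - ⟪p, a⟫ := by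
  simp [jumpIncrement, hz]

lemma jumpIncrement_of_one_lt {φ : EuclideanSpace ℝ (Fin d) → ℝ}
    {x p a z : EuclideanSpace ℝ (Fin d)} (hz : 1 < ‖z‖) :
    jumpIncrement φ x p a z = φ (x + a) - φ x := by
  simp [jumpIncrement, hz]

lemma ILI_neg (φ : EuclideanSpace ℝ (Fin d) → ℝ) (x : EuclideanSpace ℝ (Fin d)) :
    ILI μ j x (fun y => -φ y) = -ILI μ j x φ := by
  rw [ILI, ILI, ← integral_neg]
  congr 1
  ext z
  rw [gradient_fun_neg, inner_neg_left]
  ring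

lemma integrable_min_norm_sq_one (hLevy : ∫⁻ z, ENNReal.ofReal (min (‖z‖ ^ 2) 1) ∂μ < ⊤) :
    Integrable (fun z : EuclideanSpace ℝ (Fin d) => min (‖z‖ ^ 2) 1) μ :=
  ⟨((continuous_norm.pow 2).min continuous_const).aestronglyMeasurable,
    (hasFiniteIntegral_iff_ofReal (Eventually.of_forall fun z => by positivity)).2 hLevy⟩

namespace IsTestSeq

variable {u : EuclideanSpace ℝ (Fin d) → ℝ} {x p : EuclideanSpace ℝ (Fin d)}
  {X : Matrix (Fin d) (Fin d) ℝ} {φ : ℕ → EuclideanSpace ℝ (Fin d) → ℝ}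

lemma ILI_eq (h : IsTestSeq u x p X φ) (hX : X.IsSymm) (n : ℕ) :
    ILI μ j x (φ n) = ∫ z, jumpIncrement (φ n) x p (j x z) z ∂μ := by
  rw [ILI, h.gradient_eq hX]
  rfl

lemma tendsto_jumpIncrement (h : IsTestSeq u x p X φ) (a z : EuclideanSpace ℝ (Fin d)) :
    Tendsto (fun n => jumpIncrement (φ n) x p a z) atTop (𝓝 (jumpIncrement u x p a z)) :=
  ((h.tendsto _).sub (h.tendsto _)).sub tendsto_const_nhds

lemma exists_jumpIncrement_le (h : IsTestSeq u x p X φ) (hcb : 0 < cb)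
    (hjb : ∀ x z, ‖j x z‖ ≤ cb * ‖z‖) :
    ∃ C, ∀ n z, jumpIncrement (φ n) x p (j x z) z ≤ C * min (‖z‖ ^ 2) 1 := by
  obtain ⟨C, hC⟩ := h.le_quadratic
  obtain ⟨K, hK⟩ := h.bounded
  have hK0 : 0 ≤ K := (abs_nonneg _).trans (hK 0 x)
  refine ⟨|C| * cb ^ 2 + 2 * K, fun n z => ?_⟩
  have hC0 := abs_nonneg C
  rcases le_or_gt ‖z‖ 1 with hz | hz
  · rw [jumpIncrement_of_norm_le hz, min_eq_left (by nlinarith [norm_nonneg z]), h.apply_self]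
    have h1 := hC n (x + j x z)
    rw [add_sub_cancel_left] at h1
    have h2 : C * ‖j x z‖ ^ 2 ≤ |C| * (cb * ‖z‖) ^ 2 := by
      have := le_abs_self C
      have := hjb x z
      gcongr
    nlinarith [sq_nonneg ‖z‖]
  · rw [jumpIncrement_of_one_lt hz, min_eq_right (by nlinarith)]
    have h1 := abs_le.1 (hK n (x + j x z))
    have h2 := abs_le.1 (hK n x)
    have h3 : 0 ≤ |C| * cb ^ 2 := by positivity
    linarith

lemma integrable_jumpIncrement (h : IsTestSeq u x p X φ) (hcb : 0 < cb)
    (hLevy : ∫⁻ z, ENNReal.ofReal (min (‖z‖ ^ 2) 1) ∂μ < ⊤)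
    (hjm : Measurable (Function.uncurry j)) (hjb : ∀ x z, ‖j x z‖ ≤ cb * ‖z‖) (n : ℕ) :
    Integrable (fun z => jumpIncrement (φ n) x p (j x z) z) μ := by
  obtain ⟨C, hC0, hC⟩ := h.exists_abs_sub_le n
  obtain ⟨K, hK⟩ := h.bounded
  have hK0 : 0 ≤ K := (abs_nonneg _).trans (hK 0 x)
  have hjx : Measurable (j x) := hjm.of_uncurry_left
  refine ((integrable_min_norm_sq_one hLevy).const_mul (C * cb ^ 2 + 2 * K)).mono' ?_
    (Eventually.of_forall fun z => ?_)
  · have hm : Measurable fun z => φ n (x + j x z) :=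
      (h.contDiff n).continuous.measurable.comp (hjx.const_add x)
    refine Measurable.aestronglyMeasurable ((hm.sub_const _).sub (Measurable.mul ?_ ?_))
    · exact (continuous_const.inner continuous_id).measurable.comp hjx
    · exact measurable_const.indicator measurableSet_closedBall
  · rw [Real.norm_eq_abs]
    rcases le_or_gt ‖z‖ 1 with hz | hz
    · rw [jumpIncrement_of_norm_le hz, min_eq_left (by nlinarith [norm_nonneg z]), h.apply_self]
      have h1 := hC (x + j x z)
      rw [add_sub_cancel_left] at h1
      have h2 : C * ‖j x z‖ ^ 2 ≤ C * (cb * ‖z‖) ^ 2 := by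
        have := hjb x z
        gcongr
      nlinarith [sq_nonneg ‖z‖]
    · rw [jumpIncrement_of_one_lt hz, min_eq_right (by nlinarith)]
      have h1 := abs_sub (φ n (x + j x z)) (φ n x)
      have h3 : 0 ≤ C * cb ^ 2 := by positivity
      linarith [hK n (x + j x z), hK n x]

end IsTestSeq

/-- The Lévy–Itô operators of two test sequences at a pair of points obtained by
sup-convolution. -/
lemma exists_ILI_add_ILI_le (hLevy : ∫⁻ z, ENNReal.ofReal (min (‖z‖ ^ 2) 1) ∂μ < ⊤)
    (hcb : 0 < cb) (hjm : Measurable (Function.uncurry j)) (hjb : ∀ x z, ‖j x z‖ ≤ cb * ‖z‖)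
    (hjsq : ∀ x y, ∫⁻ z, ENNReal.ofReal (‖j x z - j y z‖ ^ 2) ∂μ ≤
      ENNReal.ofReal (cb * ‖x - y‖ ^ 2))
    (hjlarge : ∀ x y, ∫⁻ z in {z : EuclideanSpace ℝ (Fin d) | 1 < ‖z‖},
      ENNReal.ofReal ‖j x z - j y z‖ ∂μ ≤ ENNReal.ofReal (cb * ‖x - y‖))
    {u w : EuclideanSpace ℝ (Fin d) → ℝ} {x y z q p p' : EuclideanSpace ℝ (Fin d)}
    {X Y : Matrix (Fin d) (Fin d) ℝ} (hX : X.IsSymm) (hY : Y.IsSymm)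
    {φ ψ : ℕ → EuclideanSpace ℝ (Fin d) → ℝ} (hφ : IsTestSeq u x p X φ)
    (hψ : IsTestSeq w y p' Y ψ) {s β : ℝ} (hs : 0 < s) (hβ : 0 < β)
    (hslope : p + p' = (2 * β) • (z - q)) (hxy : x - y = s • (p - p'))
    (hinc : ∀ a b, u (x + a) - u x + (w (y + b) - w y) ≤ 1 / 2 * ⟪p - p', a - b⟫ +
      ‖a - b‖ ^ 2 / (4 * s) +
      β * (min (‖z + (1 / 2 : ℝ) • (a + b) - q‖ ^ 2) 1 - ‖z - q‖ ^ 2))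
    {σ : ℝ} (hσ : 0 < σ) :
    ∃ n, ILI μ j x (φ n) + ILI μ j y (ψ n) ≤ 3 / 4 * cb * (s * ‖p - p'‖ ^ 2) +
      β * (cb ^ 2 + 1) * ∫ ζ, min (‖ζ‖ ^ 2) 1 ∂μ + σ := by
  have hjx : Measurable (j x) := hjm.of_uncurry_left
  have hjy : Measurable (j y) := hjm.of_uncurry_left
  have hm := integrable_min_norm_sq_one hLevy
  have hnorm : ‖x - y‖ = s * ‖p - p'‖ := by rw [hxy, norm_smul, Real.norm_of_nonneg hs.le]
  set S : Set (EuclideanSpace ℝ (Fin d)) := {ζ | 1 < ‖ζ‖} with hS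
  have hSm : MeasurableSet S := (isOpen_lt continuous_const continuous_norm).measurableSet
  have hsq : Integrable (fun ζ => ‖j x ζ - j y ζ‖ ^ 2) μ :=
    integrable_of_lintegral_le ((hjx.sub hjy).norm.pow_const 2).aestronglyMeasurable
      (fun _ => sq_nonneg _) (hjsq x y)
  have hsq_le : ∫ ζ, ‖j x ζ - j y ζ‖ ^ 2 ∂μ ≤ cb * ‖x - y‖ ^ 2 :=
    integral_le_of_lintegral_le hsq.aestronglyMeasurable (fun _ => sq_nonneg _)
      (by positivity) (hjsq x y)
  have hla : Integrable (fun ζ => ‖j x ζ - j y ζ‖) (μ.restrict S) :=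
    integrable_of_lintegral_le (hjx.sub hjy).norm.aestronglyMeasurable
      (fun _ => norm_nonneg _) (hjlarge x y)
  have hla_le : ∫ ζ in S, ‖j x ζ - j y ζ‖ ∂μ ≤ cb * ‖x - y‖ :=
    integral_le_of_lintegral_le hla.aestronglyMeasurable (fun _ => norm_nonneg _)
      (by positivity) (hjlarge x y)
  rw [← integral_indicator hSm] at hla_le
  have hla' := (integrable_indicator_iff hSm).2 hla
  set H : EuclideanSpace ℝ (Fin d) → ℝ := fun ζ =>
    1 / (4 * s) * ‖j x ζ - j y ζ‖ ^ 2 +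
      1 / 2 * ‖p - p'‖ * S.indicator (fun ζ => ‖j x ζ - j y ζ‖) ζ +
      β * (cb ^ 2 + 1) * min (‖ζ‖ ^ 2) 1 with hH
  have hHint : Integrable H μ :=
    ((hsq.const_mul _).add (hla'.const_mul _)).add (hm.const_mul _)
  have hHle : ∫ ζ, H ζ ∂μ ≤ 3 / 4 * cb * (s * ‖p - p'‖ ^ 2) +
      β * (cb ^ 2 + 1) * ∫ ζ, min (‖ζ‖ ^ 2) 1 ∂μ := by
    have e1 : ∫ ζ, H ζ ∂μ = 1 / (4 * s) * ∫ ζ, ‖j x ζ - j y ζ‖ ^ 2 ∂μ +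
        1 / 2 * ‖p - p'‖ * ∫ ζ, S.indicator (fun ζ => ‖j x ζ - j y ζ‖) ζ ∂μ +
        β * (cb ^ 2 + 1) * ∫ ζ, min (‖ζ‖ ^ 2) 1 ∂μ := by
      rw [← integral_const_mul, ← integral_const_mul, ← integral_const_mul,
        ← integral_add (hsq.const_mul _) (hla'.const_mul _)]
      exact integral_add ((hsq.const_mul _).add (hla'.const_mul _)) (hm.const_mul _)
    rw [e1]
    rw [hnorm] at hsq_le hla_le
    have h1 := mul_le_mul_of_nonneg_left hsq_le (by positivity : 0 ≤ 1 / (4 * s))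
    have h2 := mul_le_mul_of_nonneg_left hla_le (by positivity : 0 ≤ 1 / 2 * ‖p - p'‖)
    have h3 : 1 / (4 * s) * (cb * (s * ‖p - p'‖) ^ 2) = 1 / 4 * cb * (s * ‖p - p'‖ ^ 2) := by
      field_simp
    rw [h3] at h1
    linarith
  have hDle : ∀ ζ, jumpIncrement u x p (j x ζ) ζ + jumpIncrement w y p' (j y ζ) ζ ≤ H ζ := by
    intro ζ
    have h1 := hinc (j x ζ) (j y ζ)
    have ha := hjb x ζ
    have hb := hjb y ζ
    simp only [hH]
    set a := j x ζ
    set b := j y ζ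
    rcases le_or_gt ‖ζ‖ 1 with hz | hz
    · rw [jumpIncrement_of_norm_le hz, jumpIncrement_of_norm_le hz,
        min_eq_left (by nlinarith [norm_nonneg ζ]),
        Set.indicator_of_notMem (by simpa [hS] using hz)]
      have h2 : ‖(1 / 2 : ℝ) • (a + b)‖ ≤ cb * ‖ζ‖ := by
        rw [norm_smul, Real.norm_of_nonneg (by norm_num)]
        linarith [norm_add_le a b]
      set c := (1 / 2 : ℝ) • (a + b) with hc
      have h3 : min (‖z + c - q‖ ^ 2) 1 ≤ ‖z - q‖ ^ 2 + 2 * ⟪z - q, c⟫ + ‖c‖ ^ 2 := by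
        rw [show z + c - q = (z - q) + c by abel, norm_add_sq_real]
        exact min_le_left _ _
      have h4 : 1 / 2 * ⟪p - p', a - b⟫ - ⟪p, a⟫ - ⟪p', b⟫ = -⟪p + p', c⟫ := by
        simp only [hc, inner_sub_left, inner_sub_right, inner_add_left, inner_add_right,
          inner_smul_right]
        ring
      rw [hslope, inner_smul_left] at h4
      simp only [conj_trivial] at h4
      have h5 : ‖c‖ ^ 2 ≤ cb ^ 2 * ‖ζ‖ ^ 2 := by
        rw [← mul_pow]
        gcongr
      have h6 := mul_le_mul_of_nonneg_left h3 hβ.le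
      have h7 := mul_le_mul_of_nonneg_left h5 hβ.le
      have h8 : ‖a - b‖ ^ 2 / (4 * s) = 1 / (4 * s) * ‖a - b‖ ^ 2 := by ring
      have h9 : 0 ≤ β * ‖ζ‖ ^ 2 := by positivity
      linarith
    · rw [jumpIncrement_of_one_lt hz, jumpIncrement_of_one_lt hz,
        min_eq_right (by nlinarith), Set.indicator_of_mem (by simpa [hS] using hz)]
      have h2 := real_inner_le_norm (p - p') (a - b)
      have h3 := mul_le_mul_of_nonneg_left (min_le_right (‖z + (1 / 2 : ℝ) • (a + b) - q‖ ^ 2) 1)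
        hβ.le
      have h4 : 0 ≤ β * ‖z - q‖ ^ 2 := by positivity
      have h5 : 0 ≤ β * cb ^ 2 := by positivity
      have h8 : ‖a - b‖ ^ 2 / (4 * s) = 1 / (4 * s) * ‖a - b‖ ^ 2 := by ring
      linarith
  obtain ⟨C, hC⟩ := hφ.exists_jumpIncrement_le hcb hjb
  obtain ⟨C', hC'⟩ := hψ.exists_jumpIncrement_le hcb hjb
  have hφi := hφ.integrable_jumpIncrement hcb hLevy hjm hjb
  have hψi := hψ.integrable_jumpIncrement hcb hLevy hjm hjb
  obtain ⟨n, hn⟩ := exists_integral_le_add (fun n => (hφi n).add (hψi n))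
    ((hm.const_mul C).add (hm.const_mul C')) hHint
    (fun n ζ => add_le_add (hC n ζ) (hC' n ζ))
    (fun ζ => (hφ.tendsto_jumpIncrement (j x ζ) ζ).add (hψ.tendsto_jumpIncrement (j y ζ) ζ))
    hDle hσ
  refine ⟨n, ?_⟩
  rw [hφ.ILI_eq hX, hψ.ILI_eq hY, ← integral_add (hφi n) (hψi n)]
  exact hn.trans (by linarith)

end Nonlocal

section DoubledJet

lemma exists_slope_supConv {E : Type*} [NormedAddCommGroup E] [InnerProductSpace ℝ E]
    [FiniteDimensional ℝ E] {u : E → ℝ} {M s : ℝ} (hu : UpperSemicontinuous u)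
    (hM : ∀ x, |u x| ≤ M) (hs : 0 < s) :
    ∃ g : E → E, IsSemiconvexWith (1 / (2 * s)) (supConv u s) g ∧
      (∀ z, supConv u s z = u (z + s • g z) - s / 2 * ‖g z‖ ^ 2) ∧
      ∀ z, supConv u s z + s / 4 * ‖g z‖ ^ 2 ≤ supConv u (2 * s) z := by
  choose m hm using exists_supConv_eq hu hM hs
  have hmz : ∀ z, z + s • ((1 / s) • (m z - z)) = m z := fun z => by
    rw [smul_smul, mul_one_div_cancel hs.ne', one_smul, add_sub_cancel]
  refine ⟨fun z => (1 / s) • (m z - z), isSemiconvexWith_supConv hM hs hm, fun z => ?_,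
    fun z => ?_⟩
  · rw [hmz, hm, norm_smul, Real.norm_of_nonneg (by positivity)]
    field_simp
  · refine le_trans (le_of_eq ?_) (supConv_add_le_supConv_two_mul hM hs (hm z))
    rw [norm_smul, Real.norm_of_nonneg (by positivity)]
    field_simp

lemma le_inner_of_eventually_le {E : Type*} [NormedAddCommGroup E] [InnerProductSpace ℝ E]
    {T : E →L[ℝ] E} {c : ℝ} (h : ∀ᶠ k in 𝓝 (0 : E), c * ‖k‖ ^ 2 ≤ ⟪T k, k⟫) (k : E) :
    c * ‖k‖ ^ 2 ≤ ⟪T k, k⟫ := by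
  have hlim : Tendsto (fun t : ℝ => t • k) (𝓝[>] 0) (𝓝 0) := by
    have : Tendsto (fun t : ℝ => t • k) (𝓝 0) (𝓝 ((0 : ℝ) • k)) :=
      tendsto_id.smul tendsto_const_nhds
    rw [zero_smul] at this
    exact this.mono_left nhdsWithin_le_nhds
  obtain ⟨t, ht, ht0⟩ := ((hlim.eventually h).and self_mem_nhdsWithin).exists
  have ht0' : 0 < t := ht0
  rw [map_smul, inner_smul_left, inner_smul_right, norm_smul, Real.norm_of_nonneg ht0'.le] at ht
  simp only [conj_trivial] at ht
  have : t ^ 2 * (c * ‖k‖ ^ 2) ≤ t ^ 2 * ⟪T k, k⟫ := by linarith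
  exact le_of_mul_le_mul_left this (by positivity)

variable {d : ℕ} {u w : EuclideanSpace ℝ (Fin d) → ℝ} {M s : ℝ}

/-- The second-order jet of `u` at the point `z + s • p` generated by a point of second-order
differentiability of its sup-convolution. -/
lemma exists_matrix_of_hasFDerivAt_slope (hM : ∀ x, |u x| ≤ M) (hs : 0 < s)
    {g : EuclideanSpace ℝ (Fin d) → EuclideanSpace ℝ (Fin d)}
    (hg : IsSemiconvexWith (1 / (2 * s)) (supConv u s) g)
    (hval : ∀ z, supConv u s z = u (z + s • g z) - s / 2 * ‖g z‖ ^ 2)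
    {z : EuclideanSpace ℝ (Fin d)} {A : EuclideanSpace ℝ (Fin d) →L[ℝ] EuclideanSpace ℝ (Fin d)}
    (hA : HasFDerivAt g A z) {θ : ℝ} (hθ : 0 < θ) :
    ∃ X Z : Matrix (Fin d) (Fin d) ℝ, X.IsSymm ∧ Z.IsSymm ∧
      (∀ ξ η, quadF X ξ - quadF Z η ≤ 1 / s * ‖ξ - η‖ ^ 2) ∧
      (∀ h, quadF Z h = ⟪A h, h⟫ + 4 * θ * ‖h‖ ^ 2) ∧ (∀ h, -(1 / s) * ‖h‖ ^ 2 ≤ quadF Z h) ∧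
      ∃ r > 0, ∀ y, ‖y - (z + s • g z)‖ < r →
        u y ≤ quadPoly (u (z + s • g z)) (z + s • g z) (g z) X y := by
  obtain ⟨N, hN, hNA⟩ := exists_isSymm_quadF_eq A
  have htaylor := hg.taylor (by positivity) hA hθ
  have hlowA : ∀ h, (-(1 / s) - 2 * θ) * ‖h‖ ^ 2 ≤ ⟪A h, h⟫ := by
    refine le_inner_of_eventually_le ?_
    filter_upwards [htaylor] with h hh
    have h1 := hg z (z + h)
    rw [add_sub_cancel_left] at h1
    have h2 := (abs_le.1 hh).2
    have h3 : 1 / (2 * s) * ‖h‖ ^ 2 = 1 / 2 * (1 / s * ‖h‖ ^ 2) := by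
      field_simp
    linarith
  set Z := N + (4 * θ) • (1 : Matrix (Fin d) (Fin d) ℝ) with hZ
  have hZs : Z.IsSymm := by
    rw [hZ, Matrix.IsSymm, Matrix.transpose_add, Matrix.transpose_smul, Matrix.transpose_one,
      hN.eq]
  have hZq : ∀ h, quadF Z h = ⟪A h, h⟫ + 4 * θ * ‖h‖ ^ 2 := fun h => by
    rw [hZ, quadF_add, quadF_smul, quadF_one, hNA]
  have hlowZ : ∀ h, (-(1 / s) + 2 * θ) * ‖h‖ ^ 2 ≤ quadF Z h := fun h => by
    rw [hZq]
    linarith [hlowA h]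
  obtain ⟨X, B, hX, hXZ, hXB⟩ := exists_parallel_sum hZs hs (by positivity : 0 < 2 * θ) hlowZ
  refine ⟨X, Z, hX, hZs, hXZ, hZq, fun h => ?_, ?_⟩
  · have : 0 ≤ 2 * θ * ‖h‖ ^ 2 := by positivity
    linarith [hlowZ h]
  have hB : Tendsto B (𝓝 0) (𝓝 0) := by
    have := B.toContinuousLinearMap.continuous.tendsto 0
    simpa using this
  obtain ⟨r, hr, hball⟩ := Metric.eventually_nhds_iff.1 (hB.eventually htaylor)
  refine ⟨r, hr, fun y hy => ?_⟩
  set x := z + s • g z with hx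
  obtain ⟨ξ, rfl⟩ : ∃ ξ, y = x + ξ := ⟨y - x, by abel⟩
  rw [add_sub_cancel_left] at hy
  have h1 := (abs_le.1 (hball (show dist ξ 0 < r by rwa [dist_zero_right]))).2
  have h2 := le_supConv hM hs (x + ξ) (z + B ξ)
  have h3 := hval z
  have h4 : ‖x + ξ - (z + B ξ)‖ ^ 2 / (2 * s) =
      s / 2 * ‖g z‖ ^ 2 + ⟪g z, ξ⟫ - ⟪g z, B ξ⟫ + 1 / 2 * (1 / s * ‖ξ - B ξ‖ ^ 2) := by
    rw [show x + ξ - (z + B ξ) = s • g z + (ξ - B ξ) by rw [hx]; abel, norm_add_sq_real,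
      norm_smul, Real.norm_of_nonneg hs.le, inner_smul_left, inner_sub_right]
    simp only [conj_trivial]
    field_simp
    ring
  rw [h4] at h2
  rw [quadPoly, add_sub_cancel_left, hXB, hZq]
  rw [← hx] at h3
  have h5 : 0 ≤ θ * ‖B ξ‖ ^ 2 := by positivity
  linarith

/-- Data produced by the doubling of variables through sup-convolutions: the functions `u` and `w`
are considered at the points `z + s • p` and `z + s • p'`. -/
structure IsDoubledJet (u w : EuclideanSpace ℝ (Fin d) → ℝ) (s β : ℝ)
    (q z p p' : EuclideanSpace ℝ (Fin d)) (X Y Z Z' : Matrix (Fin d) (Fin d) ℝ) : Prop where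
  norm_sub_lt : ‖z - q‖ < 1
  slope : p + p' = (2 * β) • (z - q)
  increment : ∀ a b, u (z + s • p + a) - u (z + s • p) + (w (z + s • p' + b) - w (z + s • p')) ≤
    1 / 2 * ⟪p - p', a - b⟫ + ‖a - b‖ ^ 2 / (4 * s) +
      β * (min (‖z + (1 / 2 : ℝ) • (a + b) - q‖ ^ 2) 1 - ‖z - q‖ ^ 2)
  symmX : X.IsSymm
  symmY : Y.IsSymm
  symmZ : Z.IsSymm
  symmZ' : Z'.IsSymm
  quadF_le : ∀ ξ η, quadF X ξ - quadF Z η ≤ 1 / s * ‖ξ - η‖ ^ 2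
  quadF_le' : ∀ ξ η, quadF Y ξ - quadF Z' η ≤ 1 / s * ‖ξ - η‖ ^ 2
  le_quadF : ∀ h, -(1 / s) * ‖h‖ ^ 2 ≤ quadF Z h
  le_quadF' : ∀ h, -(1 / s) * ‖h‖ ^ 2 ≤ quadF Z' h
  sum_le : ∀ h, quadF Z h + quadF Z' h ≤ 14 * β * ‖h‖ ^ 2
  jet : ∃ r > 0, ∀ y, ‖y - (z + s • p)‖ < r →
    u y ≤ quadPoly (u (z + s • p)) (z + s • p) p X y
  jet' : ∃ r > 0, ∀ y, ‖y - (z + s • p')‖ < r →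
    w y ≤ quadPoly (w (z + s • p')) (z + s • p') p' Y y

lemma increment_le_of_isTouching (hM : ∀ x, |u x| ≤ M) (hMw : ∀ x, |w x| ≤ M) (hs : 0 < s)
    {β : ℝ} {q z p p' : EuclideanSpace ℝ (Fin d)}
    (htouch : IsTouching β (supConv u s + supConv w s) q z)
    (hp : supConv u s z = u (z + s • p) - s / 2 * ‖p‖ ^ 2)
    (hp' : supConv w s z = w (z + s • p') - s / 2 * ‖p'‖ ^ 2) (a b : EuclideanSpace ℝ (Fin d)) :
    u (z + s • p + a) - u (z + s • p) + (w (z + s • p' + b) - w (z + s • p')) ≤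
      1 / 2 * ⟪p - p', a - b⟫ + ‖a - b‖ ^ 2 / (4 * s) +
        β * (min (‖z + (1 / 2 : ℝ) • (a + b) - q‖ ^ 2) 1 - ‖z - q‖ ^ 2) := by
  set c := (1 / 2 : ℝ) • (a + b) with hc
  have h1 := le_supConv hM hs (z + s • p + a) (z + c)
  have h2 := le_supConv hMw hs (z + s • p' + b) (z + c)
  have h3 := htouch.2 (z + c)
  simp only [Pi.add_apply] at h3
  have h4 : ‖z + s • p + a - (z + c)‖ ^ 2 / (2 * s) =
      s / 2 * ‖p‖ ^ 2 + 1 / 2 * ⟪p, a - b⟫ + ‖a - b‖ ^ 2 / (8 * s) := by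
    rw [show z + s • p + a - (z + c) = s • p + (1 / 2 : ℝ) • (a - b) by rw [hc]; module,
      norm_add_sq_real, norm_smul, norm_smul, Real.norm_of_nonneg hs.le,
      Real.norm_of_nonneg (by norm_num), inner_smul_left, inner_smul_right]
    simp only [conj_trivial]
    field_simp
    ring
  have h5 : ‖z + s • p' + b - (z + c)‖ ^ 2 / (2 * s) =
      s / 2 * ‖p'‖ ^ 2 - 1 / 2 * ⟪p', a - b⟫ + ‖a - b‖ ^ 2 / (8 * s) := by
    rw [show z + s • p' + b - (z + c) = s • p' - (1 / 2 : ℝ) • (a - b) by rw [hc]; module,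
      norm_sub_sq_real, norm_smul, norm_smul, Real.norm_of_nonneg hs.le,
      Real.norm_of_nonneg (by norm_num), inner_smul_left, inner_smul_right]
    simp only [conj_trivial]
    field_simp
    ring
  have h6 : ‖a - b‖ ^ 2 / (4 * s) = ‖a - b‖ ^ 2 / (8 * s) + ‖a - b‖ ^ 2 / (8 * s) := by
    field_simp
    ring
  rw [inner_sub_left]
  linarith

lemma exists_isDoubledJet (hu : UpperSemicontinuous u) (hw : UpperSemicontinuous w)
    (hM : ∀ x, |u x| ≤ M) (hMw : ∀ x, |w x| ≤ M) (hs : 0 < s) {β : ℝ} (hβ : 0 < β)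
    {z₀ : EuclideanSpace ℝ (Fin d)}
    (hz₀ : ∀ z, supConv u s z + supConv w s z ≤ supConv u s z₀ + supConv w s z₀ + β / 2) :
    ∃ q z p p' X Y Z Z', IsDoubledJet u w s β q z p p' X Y Z Z' ∧
      supConv u s z₀ + supConv w s z₀ - β / 4 ≤ supConv u s z + supConv w s z ∧
      supConv u s z + supConv w s z ≤ u (z + s • p) + w (z + s • p') ∧
      supConv u s z + supConv w s z + s / 4 * (‖p‖ ^ 2 + ‖p'‖ ^ 2) ≤
        supConv u (2 * s) z + supConv w (2 * s) z := by
  obtain ⟨g, hg, hgv, hg2⟩ := exists_slope_supConv hu hM hs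
  obtain ⟨g', hg', hgv', hg2'⟩ := exists_slope_supConv hw hMw hs
  obtain ⟨q, z, htouch, hz, ⟨A, hA⟩, ⟨A', hA'⟩⟩ := exists_isTouching_differentiableAt hg hg'
    (by positivity) hβ ((continuous_supConv hu hM hs).add (continuous_supConv hw hMw hs)) hz₀
  obtain ⟨X, Z, hX, hZ, hXZ, hZA, hlow, hjet⟩ :=
    exists_matrix_of_hasFDerivAt_slope hM hs hg hgv hA hβ
  obtain ⟨Y, Z', hY, hZ', hYZ, hZA', hlow', hjet'⟩ :=
    exists_matrix_of_hasFDerivAt_slope hMw hs hg' hgv' hA' hβ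
  have hslope := htouch.slope_add_slope hg hg' hβ.le
  refine ⟨q, z, g z, g' z, X, Y, Z, Z', ⟨htouch.1, hslope,
    increment_le_of_isTouching hM hMw hs htouch (hgv z) (hgv' z), hX, hY, hZ, hZ', hXZ, hYZ,
    hlow, hlow', fun h => ?_, hjet, hjet'⟩, ?_, ?_, ?_⟩
  · have h1 : ∀ k, -(6 * β) * ‖k‖ ^ 2 ≤ ⟪(-(A + A')) k, k⟫ := by
      refine le_inner_of_eventually_le ?_
      filter_upwards [hg.taylor (by positivity) hA hβ, hg'.taylor (by positivity) hA' hβ]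
        with k hk hk'
      have h2 := htouch.le_add_inner hβ.le (z + k)
      rw [add_sub_cancel_left, ← hslope, inner_add_left] at h2
      simp only [Pi.add_apply] at h2
      have h3 := (abs_le.1 hk).1
      have h4 := (abs_le.1 hk').1
      simp only [neg_apply, add_apply, inner_neg_left, inner_add_left]
      linarith
    have h2 := h1 h
    simp only [neg_apply, add_apply, inner_neg_left, inner_add_left] at h2
    rw [hZA, hZA']
    linarith
  · have : 0 ≤ β * ‖z - q‖ ^ 2 := by positivity
    simp only [Pi.add_apply] at hz
    linarith
  · have h1 : 0 ≤ s / 2 * ‖g z‖ ^ 2 := by positivity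
    have h2 : 0 ≤ s / 2 * ‖g' z‖ ^ 2 := by positivity
    linarith [hgv z, hgv' z]
  · linarith [hg2 z, hg2' z]

end DoubledJet

section Comparison

lemma exists_two_mul_sub_le {f : ℝ → ℝ} {K : ℝ} (hf : ∀ s, 0 < s → |f s| ≤ K) {c : ℝ}
    (hc : 0 < c) : ∃ s, 0 < s ∧ s ≤ 1 ∧ f (2 * s) - f s ≤ c := by
  by_contra! hcon
  have h1 : ∀ n : ℕ, f ((1 / 2) ^ n) ≤ f 1 - n * c := fun n => by
    induction n with
    | zero => simp
    | succ n ih =>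
      have h2 := hcon ((1 / 2) ^ (n + 1)) (by positivity) (pow_le_one₀ (by norm_num) (by norm_num))
      rw [show (2 : ℝ) * (1 / 2) ^ (n + 1) = (1 / 2) ^ n by rw [pow_succ]; ring] at h2
      push_cast
      linarith
  obtain ⟨n, hn⟩ := exists_nat_gt (2 * K / c)
  rw [div_lt_iff₀ hc] at hn
  linarith [h1 n, (abs_le.1 (hf ((1 / 2) ^ n) (by positivity))).1, (abs_le.1 (hf 1 one_pos)).2]

lemma IsModulus.exists_le {ω : ℝ → ℝ} (hω : IsModulus ω) {κ : ℝ} (hκ : 0 < κ) :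
    ∃ δ > 0, ∀ t, 0 ≤ t → t < δ → ω t ≤ κ := by
  obtain ⟨-, -, h0, hc⟩ := hω
  obtain ⟨δ, hδ, h⟩ := Metric.continuousWithinAt_iff.1 hc κ hκ
  refine ⟨δ, hδ, fun t ht htδ => ?_⟩
  have h1 := h (show t ∈ Set.Ici 0 from ht)
    (by rwa [Real.dist_eq, sub_zero, abs_of_nonneg ht])
  rw [h0, Real.dist_eq, sub_zero] at h1
  exact (le_abs_self _).trans h1.le

variable {d : ℕ}
  {F : EuclideanSpace ℝ (Fin d) → ℝ → EuclideanSpace ℝ (Fin d) →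
    Matrix (Fin d) (Fin d) ℝ → ℝ → ℝ}

/-- The structure condition (A3-2) applied on both sides of the intermediate point `z`. -/
lemma mul_sub_le_of_isDoubledJet (hFe : DegEll F) {γ L R : ℝ}
    (hA2 : ∀ x (a b : ℝ) p (X : Matrix (Fin d) (Fin d) ℝ) (l : ℝ),
      b ≤ a → γ * (a - b) ≤ F x a p X l - F x b p X l)
    (hA4 : ∀ x (a : ℝ) p (X : Matrix (Fin d) (Fin d) ℝ) (l l' : ℝ),
      |F x a p X l - F x a p X l'| ≤ L * |l - l'|) {ω : ℝ → ℝ}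
    (hω : ∀ ε > (0:ℝ), ∀ x y : EuclideanSpace ℝ (Fin d), ∀ a : ℝ, |a| ≤ R → ∀ l : ℝ,
      ∀ X Y : Matrix (Fin d) (Fin d) ℝ, X.IsSymm → Y.IsSymm →
      (∀ ξ η : EuclideanSpace ℝ (Fin d),
        quadF X ξ - quadF Y η ≤ (1 / ε) * ‖ξ - η‖ ^ 2) →
      F y a ((1 / ε) • (x - y)) Y l - F x a ((1 / ε) • (x - y)) X l ≤
        ω (‖x - y‖ ^ 2 / ε + ‖x - y‖))
    {u w : EuclideanSpace ℝ (Fin d) → ℝ} {s β : ℝ} (hs : 0 < s)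
    {q z p p' : EuclideanSpace ℝ (Fin d)} {X Y Z Z' : Matrix (Fin d) (Fin d) ℝ}
    (h : IsDoubledJet u w s β q z p p' X Y Z Z') {a b l l' κ e : ℝ} (hba : b ≤ a)
    (ha : |a| ≤ R) (hb : |b| ≤ R) (he : 0 ≤ e) (hl : l ≤ l' + e) (hL : 0 ≤ L)
    (hpert : F z b (-p') (-Z') l ≤
      F z b p (-Z' + (14 * β) • (1 : Matrix (Fin d) (Fin d) ℝ)) l + κ)
    (hsub : F (z + s • p) a p X l ≤ 0) (hsup : 0 ≤ F (z + s • p') b (-p') (-Y) l') :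
    γ * (a - b) ≤ ω (s * ‖p‖ ^ 2 + s * ‖p‖) + ω (s * ‖p'‖ ^ 2 + s * ‖p'‖) + κ + L * e := by
  have hnorm : ∀ p : EuclideanSpace ℝ (Fin d), ‖s • p‖ = s * ‖p‖ := fun p => by
    rw [norm_smul, Real.norm_of_nonneg hs.le]
  have hsq : ∀ r : ℝ, (s * r) ^ 2 / s = s * r ^ 2 := fun r => by field_simp
  have hscale : ∀ p : EuclideanSpace ℝ (Fin d), (1 / s) • (s • p) = p := fun p => by
    rw [smul_smul, one_div_mul_cancel hs.ne', one_smul]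
  have h1 := hω s hs (z + s • p) z a ha l X Z h.symmX h.symmZ h.quadF_le
  rw [add_sub_cancel_left, hscale, hnorm, hsq] at h1
  have h2 := hω s hs z (z + s • p') b hb l (-Z') (-Y) h.symmZ'.neg h.symmY.neg fun ξ η => by
    rw [quadF_neg, quadF_neg, norm_sub_rev]
    linarith [h.quadF_le' η ξ]
  rw [sub_add_cancel_left, smul_neg, hscale, norm_neg, hnorm, hsq] at h2
  have h3 := hA2 z a b p Z l hba
  have hsymm : (-Z' + (14 * β) • (1 : Matrix (Fin d) (Fin d) ℝ) - Z).IsSymm := by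
    simp only [Matrix.IsSymm, Matrix.transpose_sub, Matrix.transpose_add, Matrix.transpose_neg,
      Matrix.transpose_smul, Matrix.transpose_one, h.symmZ.eq, h.symmZ'.eq]
  have h4 := hFe z b p (-Z' + (14 * β) • (1 : Matrix (Fin d) (Fin d) ℝ)) Z l l
    (posSemidef_of_quadF_nonneg hsymm fun k => by
      rw [quadF_sub, quadF_add, quadF_neg, quadF_smul, quadF_one]
      linarith [h.sum_le k]) le_rfl
  have h5 : F (z + s • p') b (-p') (-Y) l' ≤ F (z + s • p') b (-p') (-Y) l + L * e := by
    rcases le_total l l' with hll | hll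
    · have := hFe (z + s • p') b (-p') (-Y) (-Y) l' l
        (by rw [sub_self]; exact Matrix.PosSemidef.zero) hll
      linarith [mul_nonneg hL he]
    · have h6 := (abs_le.1 (hA4 (z + s • p') b (-p') (-Y) l l')).1
      have h7 : L * |l - l'| ≤ L * e := by
        rw [abs_of_nonneg (by linarith)]
        gcongr
        linarith
      linarith
  linarith

lemma IsDoubledJet.abs_entry_le {u w : EuclideanSpace ℝ (Fin d) → ℝ} {s β : ℝ} (hs : 0 < s)
    (hβ : 0 ≤ β) {q z p p' : EuclideanSpace ℝ (Fin d)} {X Y Z Z' : Matrix (Fin d) (Fin d) ℝ}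
    (h : IsDoubledJet u w s β q z p p' X Y Z Z') (i k : Fin d) :
    |(-Z') i k| ≤ 3 * (1 / s + 28 * β) ∧
      |(-Z' + (14 * β) • (1 : Matrix (Fin d) (Fin d) ℝ)) i k| ≤ 3 * (1 / s + 28 * β) := by
  have hC : 0 ≤ 1 / s + 28 * β := by positivity
  have hnn : ∀ k : EuclideanSpace ℝ (Fin d), 0 ≤ β * ‖k‖ ^ 2 := fun k => by positivity
  refine ⟨abs_entry_le_of_abs_quadF_le h.symmZ'.neg hC (fun k => ?_) i k,
    abs_entry_le_of_abs_quadF_le ?_ hC (fun k => ?_) i k⟩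
  · rw [quadF_neg, abs_neg, abs_le]
    constructor <;> linarith [h.le_quadF k, h.le_quadF' k, h.sum_le k, hnn k]
  · simp only [Matrix.IsSymm, Matrix.transpose_add, Matrix.transpose_neg,
      Matrix.transpose_smul, Matrix.transpose_one, h.symmZ'.eq]
  · rw [quadF_add, quadF_neg, quadF_smul, quadF_one, abs_le]
    constructor <;> linarith [h.le_quadF k, h.le_quadF' k, h.sum_le k, hnn k]

variable {μ : Measure (EuclideanSpace ℝ (Fin d))}
  {j : EuclideanSpace ℝ (Fin d) → EuclideanSpace ℝ (Fin d) → EuclideanSpace ℝ (Fin d)}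
  {φ : ℕ → EuclideanSpace ℝ (Fin d) → ℝ} {x p : EuclideanSpace ℝ (Fin d)}
  {X : Matrix (Fin d) (Fin d) ℝ}

lemma IsSubsolution.apply_testSeq {u : EuclideanSpace ℝ (Fin d) → ℝ}
    (hu : IsSubsolution F μ j u) (hX : X.IsSymm) (h : IsTestSeq u x p X φ) (n : ℕ) :
    F x (u x) p X (ILI μ j x (φ n)) ≤ 0 := by
  have h1 := hu (φ n) (h.contDiff n) (h.bounded.imp fun K hK => hK n) x fun y => by
    rw [h.apply_self]
    linarith [h.le n y]
  rwa [h.gradient_eq hX, h.hessM_eq hX] at h1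

lemma IsSupersolution.apply_testSeq {v : EuclideanSpace ℝ (Fin d) → ℝ}
    (hv : IsSupersolution F μ j v) (hX : X.IsSymm) (h : IsTestSeq (fun y => -v y) x p X φ)
    (n : ℕ) : 0 ≤ F x (v x) (-p) (-X) (-ILI μ j x (φ n)) := by
  have h1 := hv (fun y => -φ n y) (h.contDiff n).neg
    (h.bounded.imp fun K hK y => by rw [abs_neg]; exact hK n y) x fun y => by
      rw [h.apply_self]
      linarith [h.le n y]
  rwa [gradient_fun_neg, hessM_fun_neg, ILI_neg, h.gradient_eq hX, h.hessM_eq hX] at h1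

end Comparison

/-- Choosing `s` where the supremum of `supConv u s + supConv w s` is nearly stationary under
`s ↦ 2 * s` makes the slopes of doubled jets small. -/
lemma exists_isDoubledJet_of_slope_le {d : ℕ} {u w : EuclideanSpace ℝ (Fin d) → ℝ} {M : ℝ}
    (hu : UpperSemicontinuous u) (hw : UpperSemicontinuous w) (hM : ∀ x, |u x| ≤ M)
    (hMw : ∀ x, |w x| ≤ M) {t : ℝ} (ht : 0 < t) :
    ∃ s, 0 < s ∧ s ≤ 1 ∧ ∀ β, 0 < β → β ≤ t ^ 2 / 8 →
      ∃ q z p p' X Y Z Z', IsDoubledJet u w s β q z p p' X Y Z Z' ∧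
        (∀ x, u x + w x - β ≤ u (z + s • p) + w (z + s • p')) ∧
        s * (‖p‖ ^ 2 + ‖p'‖ ^ 2) ≤ t ^ 2 := by
  have hub : ∀ s, 0 < s → ∀ z, supConv u s z + supConv w s z ≤ 2 * M := fun s hs z => by
    linarith [supConv_le hM hs z, supConv_le hMw hs z]
  have hbdd : ∀ s, 0 < s → BddAbove (Set.range fun z => supConv u s z + supConv w s z) :=
    fun s hs => ⟨2 * M, by rintro _ ⟨z, rfl⟩; exact hub s hs z⟩
  have hbound : ∀ s, 0 < s → |⨆ z, (supConv u s z + supConv w s z)| ≤ 2 * M := fun s hs => by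
    refine abs_le.2 ⟨?_, ciSup_le (hub s hs)⟩
    have h1 := le_ciSup (hbdd s hs) 0
    have h2 := self_le_supConv hM hs 0
    have h3 := self_le_supConv hMw hs 0
    have h4 := (abs_le.1 (hM 0)).1
    have h5 := (abs_le.1 (hMw 0)).1
    linarith
  obtain ⟨s, hs, hs1, hdiff⟩ := exists_two_mul_sub_le hbound (c := t ^ 2 / 8) (by positivity)
  refine ⟨s, hs, hs1, fun β hβ hβt => ?_⟩
  obtain ⟨z₀, hz₀⟩ := exists_lt_of_lt_ciSup
    (show (⨆ z, (supConv u s z + supConv w s z)) - β / 2 < ⨆ z, (supConv u s z + supConv w s z)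
      by linarith)
  have hsup : ∀ z, supConv u s z + supConv w s z ≤ ⨆ z, (supConv u s z + supConv w s z) :=
    fun z => le_ciSup (hbdd s hs) z
  obtain ⟨q, z, p, p', X, Y, Z, Z', hjet, h1, h2, h3⟩ :=
    exists_isDoubledJet hu hw hM hMw hs hβ (z₀ := z₀) fun z => by linarith [hsup z]
  refine ⟨q, z, p, p', X, Y, Z, Z', hjet, fun x => ?_, ?_⟩
  · linarith [hsup x, self_le_supConv hM hs x, self_le_supConv hMw hs x]
  · have h4 : supConv u (2 * s) z + supConv w (2 * s) z ≤
        ⨆ z, (supConv u (2 * s) z + supConv w (2 * s) z) :=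
      le_ciSup (hbdd (2 * s) (by positivity)) z
    nlinarith

lemma mul_norm_le_of_slope_le {E : Type*} [NormedAddCommGroup E] {s t : ℝ} (hs : 0 < s)
    (hs1 : s ≤ 1) (ht : 0 < t) (ht1 : t ≤ 1) {p : E} (hp : s * ‖p‖ ^ 2 ≤ t ^ 2) :
    s * ‖p‖ ^ 2 + s * ‖p‖ ≤ 2 * t ∧ ‖p‖ ≤ 1 / s := by
  have h1 : s * ‖p‖ ≤ t := by
    refine abs_le_of_sq_le_sq' ?_ ht.le |>.2
    nlinarith [mul_nonneg hs.le (sq_nonneg ‖p‖)]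
  refine ⟨by nlinarith, ?_⟩
  rw [le_div_iff₀ hs]
  linarith

lemma mul_norm_sub_sq_le_of_slope_le {E : Type*} [NormedAddCommGroup E] {s t : ℝ} (hs : 0 < s)
    (ht : 0 < t) (ht1 : t ≤ 1) {p p' : E} (hp : s * (‖p‖ ^ 2 + ‖p'‖ ^ 2) ≤ t ^ 2) :
    s * ‖p - p'‖ ^ 2 ≤ 2 * t := by
  have h1 : ‖p - p'‖ ^ 2 ≤ 2 * (‖p‖ ^ 2 + ‖p'‖ ^ 2) := by
    nlinarith [norm_sub_le p p', norm_nonneg (p - p'), sq_nonneg (‖p‖ - ‖p'‖)]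
  nlinarith

lemma mul_nonlocal_error_le {L c D t κ β Λ : ℝ} (hL : 0 < L) (hc : 0 < c)
    (hκ : 0 ≤ κ) (hD : D ≤ 2 * t) (ht : t * (2 * L * c) ≤ κ) (hβ : 0 ≤ β)
    (hβκ : β * (L * (c ^ 2 + 1) * (Λ + 1)) ≤ κ) :
    L * (3 / 4 * c * D + β * (c ^ 2 + 1) * Λ + κ / L) ≤ 3 * κ := by
  have h1 : L * c * D ≤ L * c * (2 * t) := by gcongr
  have h2 : 0 ≤ β * (L * (c ^ 2 + 1)) := by positivity
  have h3 : L * (κ / L) = κ := by field_simp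
  have h4 : L * (3 / 4 * c * D + β * (c ^ 2 + 1) * Λ + κ / L) = 3 / 4 * (L * c * D) +
      (β * (L * (c ^ 2 + 1) * (Λ + 1)) - β * (L * (c ^ 2 + 1))) + L * (κ / L) := by ring
  linarith

/-- comparison principle under assumptions (A1), (A2), (A3-2), (A4). -/
theorem statement9 {d : ℕ} (μ : Measure (EuclideanSpace ℝ (Fin d)))
    (hLevy : ∫⁻ z, ENNReal.ofReal (min (‖z‖ ^ 2) 1) ∂μ < ⊤)
    (cb : ℝ) (hcb : 0 < cb)
    (j : EuclideanSpace ℝ (Fin d) → EuclideanSpace ℝ (Fin d) → EuclideanSpace ℝ (Fin d))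
    (hjm : Measurable (Function.uncurry j))
    (hjb : ∀ x z, ‖j x z‖ ≤ cb * ‖z‖)
    (hjc : ∀ z, Continuous fun x => j x z)
    (F : EuclideanSpace ℝ (Fin d) → ℝ → EuclideanSpace ℝ (Fin d) →
      Matrix (Fin d) (Fin d) ℝ → ℝ → ℝ)
    (hFc : Continuous fun ξ : EuclideanSpace ℝ (Fin d) × ℝ × EuclideanSpace ℝ (Fin d) ×
      Matrix (Fin d) (Fin d) ℝ × ℝ => F ξ.1 ξ.2.1 ξ.2.2.1 ξ.2.2.2.1 ξ.2.2.2.2)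
    (hFe : DegEll F)
    -- (A1)
    (hA1a : μ {z : EuclideanSpace ℝ (Fin d) | 1 < ‖z‖} < ⊤)
    (hA1b : ∃ C : ℝ, ∀ x, ∫⁻ z in {z : EuclideanSpace ℝ (Fin d) | ‖z‖ ≤ 1},
      ENNReal.ofReal (‖j x z‖ ^ 2) ∂μ ≤ ENNReal.ofReal C)
    (hA1c : ∀ x y, ∫⁻ z, ENNReal.ofReal (‖j x z - j y z‖ ^ 2) ∂μ ≤
      ENNReal.ofReal (cb * ‖x - y‖ ^ 2))
    (hA1d : ∀ x y, ∫⁻ z in {z : EuclideanSpace ℝ (Fin d) | 1 < ‖z‖},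
      ENNReal.ofReal ‖j x z - j y z‖ ∂μ ≤ ENNReal.ofReal (cb * ‖x - y‖))
    -- (A2)
    (γ : ℝ) (hγ : 0 < γ)
    (hA2 : ∀ x (a b : ℝ) p (X : Matrix (Fin d) (Fin d) ℝ) (l : ℝ),
      b ≤ a → γ * (a - b) ≤ F x a p X l - F x b p X l)
    -- (A3-2), first part: uniform continuity of `F` on `ℝ^d × [−R,R] × B_R × D_R × ℝ`
    (hA32a : ∀ R > (0:ℝ), ∀ ε > (0:ℝ), ∃ η > (0:ℝ),
      ∀ (x₁ x₂ : EuclideanSpace ℝ (Fin d)) (a₁ a₂ : ℝ) (p₁ p₂ : EuclideanSpace ℝ (Fin d))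
        (X₁ X₂ : Matrix (Fin d) (Fin d) ℝ) (l₁ l₂ : ℝ),
        |a₁| ≤ R → |a₂| ≤ R → ‖p₁‖ ≤ R → ‖p₂‖ ≤ R →
        (∀ i k, |X₁ i k| ≤ R) → (∀ i k, |X₂ i k| ≤ R) →
        ‖x₁ - x₂‖ ≤ η → |a₁ - a₂| ≤ η → ‖p₁ - p₂‖ ≤ η →
        (∀ i k, |X₁ i k - X₂ i k| ≤ η) → |l₁ - l₂| ≤ η →
        |F x₁ a₁ p₁ X₁ l₁ - F x₂ a₂ p₂ X₂ l₂| ≤ ε)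
    -- (A3-2), second part
    (hA32b : ∀ R > (0:ℝ), ∃ ωR : ℝ → ℝ, IsModulus ωR ∧
      ∀ ε > (0:ℝ), ∀ x y : EuclideanSpace ℝ (Fin d), ∀ a : ℝ, |a| ≤ R → ∀ l : ℝ,
        ∀ X Y : Matrix (Fin d) (Fin d) ℝ, X.IsSymm → Y.IsSymm →
        (∀ ξ η : EuclideanSpace ℝ (Fin d),
          quadF X ξ - quadF Y η ≤ (1 / ε) * ‖ξ - η‖ ^ 2) →
        F y a ((1 / ε) • (x - y)) Y l - F x a ((1 / ε) • (x - y)) X l ≤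
          ωR (‖x - y‖ ^ 2 / ε + ‖x - y‖))
    -- (A4)
    (L : ℝ) (hL : 0 < L)
    (hA4 : ∀ x (a : ℝ) p (X : Matrix (Fin d) (Fin d) ℝ) (l l' : ℝ),
      |F x a p X l - F x a p X l'| ≤ L * |l - l'|)
    (u v : EuclideanSpace ℝ (Fin d) → ℝ)
    (hu : UpperSemicontinuous u) (hub : ∃ C, ∀ x, |u x| ≤ C)
    (hv : LowerSemicontinuous v) (hvb : ∃ C, ∀ x, |v x| ≤ C)
    (husub : IsSubsolution F μ j u) (hvsuper : IsSupersolution F μ j v) :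
    ∀ x, u x ≤ v x := by
  by_contra! hcon
  obtain ⟨x₀, hx₀⟩ := hcon
  obtain ⟨C, hC⟩ := hub
  obtain ⟨C', hC'⟩ := hvb
  set M := max C C' with hM_def
  have hM : ∀ x, |u x| ≤ M := fun x => (hC x).trans (le_max_left _ _)
  have hMv : ∀ x, |v x| ≤ M := fun x => (hC' x).trans (le_max_right _ _)
  have hM0 : 0 ≤ M := (abs_nonneg _).trans (hM 0)
  have hw : UpperSemicontinuous fun y => -v y := hv.neg
  set m := u x₀ - v x₀ with hm_def
  have hm : 0 < m := sub_pos.2 hx₀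
  set κ := γ * m / 32 with hκ_def
  have hκ : 0 < κ := by positivity
  obtain ⟨ω, hω, hωF⟩ := hA32b (M + 1) (by positivity)
  obtain ⟨δ, hδ, hωδ⟩ := hω.exists_le hκ
  obtain ⟨t, ht, ht1, htδ, htL⟩ : ∃ t : ℝ, 0 < t ∧ t ≤ 1 ∧ t ≤ δ / 4 ∧ t ≤ κ / (2 * L * cb) :=
    ⟨min 1 (min (δ / 4) (κ / (2 * L * cb))), by positivity, min_le_left _ _,
      (min_le_right _ _).trans (min_le_left _ _), (min_le_right _ _).trans (min_le_right _ _)⟩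
  rw [le_div_iff₀ (by positivity)] at htL
  obtain ⟨s, hs, hs1, hjets⟩ := exists_isDoubledJet_of_slope_le hu hw hM
    (fun x => by rw [abs_neg]; exact hMv x) ht
  set Λ := ∫ ζ, min (‖ζ‖ ^ 2) 1 ∂μ with hΛ_def
  have hΛ : 0 ≤ Λ := integral_nonneg fun ζ => by positivity
  set R := M + 3 * (1 / s + 28) + 1 / s + 1 with hR_def
  have hs' : 0 < 1 / s := by positivity
  obtain ⟨η, hη, hFη⟩ := hA32a R (by positivity) κ hκ
  obtain ⟨β, hβ, hβ1, hβm, hβη, hβt, hβL⟩ : ∃ β : ℝ, 0 < β ∧ β ≤ 1 ∧ β ≤ m / 2 ∧ β ≤ η / 14 ∧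
      β ≤ t ^ 2 / 8 ∧ β ≤ κ / (L * (cb ^ 2 + 1) * (Λ + 1)) :=
    ⟨min 1 (min (m / 2) (min (η / 14) (min (t ^ 2 / 8) (κ / (L * (cb ^ 2 + 1) * (Λ + 1)))))),
      by positivity, by simp⟩
  rw [le_div_iff₀ (by positivity)] at hβL
  obtain ⟨q, z, p, p', X, Y, Z, Z', h, hgap, hslope⟩ := hjets β hβ hβt
  have hgap₀ : m / 2 ≤ u (z + s • p) - v (z + s • p') := by
    have := hgap x₀
    linarith
  obtain ⟨hpt, hp_le⟩ := mul_norm_le_of_slope_le hs hs1 ht ht1 (p := p)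
    (hslope.trans' (by gcongr; exact le_add_of_nonneg_right (sq_nonneg _)))
  obtain ⟨hpt', hp'_le⟩ := mul_norm_le_of_slope_le hs hs1 ht ht1 (p := p')
    (hslope.trans' (by gcongr; exact le_add_of_nonneg_left (sq_nonneg _)))
  have hsum : ‖p + p'‖ ≤ 2 * β := by
    rw [h.slope, norm_smul, Real.norm_of_nonneg (by positivity)]
    exact mul_le_of_le_one_right (by positivity) h.norm_sub_lt.le
  have hdiff := mul_norm_sub_sq_le_of_slope_le hs ht ht1 hslope
  obtain ⟨r, hr, hjet⟩ := h.jet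
  obtain ⟨r', hr', hjet'⟩ := h.jet'
  obtain ⟨φ, hφ⟩ := exists_isTestSeq hu hM hr hjet
  obtain ⟨ψ, hψ⟩ := exists_isTestSeq hw (fun x => by rw [abs_neg]; exact hMv x) hr' hjet'
  obtain ⟨n, hn⟩ := exists_ILI_add_ILI_le hLevy hcb hjm hjb hA1c hA1d h.symmX h.symmY hφ hψ hs hβ
    h.slope (by module) h.increment (σ := κ / L) (by positivity)
  have hpert : ∀ l, F z (v (z + s • p')) (-p') (-Z') l ≤ F z (v (z + s • p')) p
      (-Z' + (14 * β) • (1 : Matrix (Fin d) (Fin d) ℝ)) l + κ := fun l => by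
    have hvR : |v (z + s • p')| ≤ R := (hMv _).trans (by linarith)
    have hentry : 3 * (1 / s + 28 * β) ≤ R := by linarith
    have := hFη z z (v (z + s • p')) (v (z + s • p')) (-p') p (-Z')
      (-Z' + (14 * β) • (1 : Matrix (Fin d) (Fin d) ℝ)) l l hvR hvR
      (by rw [norm_neg]; linarith) (by linarith)
      (fun i k => (h.abs_entry_le hs hβ.le i k).1.trans hentry)
      (fun i k => (h.abs_entry_le hs hβ.le i k).2.trans hentry)
      (by simpa using hη.le) (by simpa using hη.le)
      (by rw [show -p' - p = -(p + p') by abel, norm_neg]; linarith)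
      (fun i k => by
        by_cases hik : i = k
        · simp [hik, abs_of_pos hβ]; linarith
        · simp [hik, hη.le])
      (by simpa using hη.le)
    linarith [(abs_le.1 this).2]
  have he := mul_nonlocal_error_le hL hcb hκ.le hdiff htL hβ.le hβL
  have key := mul_sub_le_of_isDoubledJet (R := M + 1) hFe hA2 hA4 hωF hs h
    (a := u (z + s • p)) (b := v (z + s • p')) (l := ILI μ j (z + s • p) (φ n))
    (l' := -ILI μ j (z + s • p') (ψ n))
    (e := 3 / 4 * cb * (s * ‖p - p'‖ ^ 2) + β * (cb ^ 2 + 1) * Λ + κ / L) (by linarith)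
    ((hM _).trans (by linarith))
    ((hMv _).trans (by linarith)) (by positivity) (by linarith) hL.le (hpert _)
    (husub.apply_testSeq h.symmX hφ n) (hvsuper.apply_testSeq h.symmY hψ n)
  have hω₁ := hωδ (s * ‖p‖ ^ 2 + s * ‖p‖) (by positivity) (by linarith)
  have hω₂ := hωδ (s * ‖p'‖ ^ 2 + s * ‖p'‖) (by positivity) (by linarith)
  have hγm : γ * (m / 2) ≤ γ * (u (z + s • p) - v (z + s • p')) := by gcongr
  linarith
end

section
/- (Stability under half-relaxed limits.) Assume j(·,z) is continuous on ℝ^d for every z. Let (F_ε)_{ε∈(0,1]} be a family of continuous degenerate elliptic functions ℝ^d×ℝ×ℝ^d×S^d×ℝ→ℝ that is uniformly bounded on every compact set, and let (u^ε)_{ε∈(0,1]} be usc functions with sup_ε sup_x |u^ε(x)| < ∞ such that each u^ε is a bounded usc viscosity subsolution of F_ε(x,w,∇w,D²w,I_LI[x,w]) = 0 on ℝ^d. Define ū(x) := limsup of u^ε(y) as ε→0⁺ and y→x, and F̲(ξ) := liminf of F_ε(ζ) as ε→0⁺ and ζ→ξ (which is finite by the local uniform boundedness). Then ū is bounded, usc,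 and is a viscosity subsolution of F̲(x,w,∇w,D²w,I_LI[x,w]) = 0, i.e. for every bounded C² function φ:ℝ^d→ℝ and every global maximum point x of ū−φ one has F̲(x,ū(x),∇φ(x),D²φ(x),I_LI[x,φ]) ≤ 0. -/
open scoped RealInnerProductSpace
open Filter Metric MeasureTheory Topology

section Limits

variable {X : Type*} [TopologicalSpace X]

/-- Partial limsups over a product with a neighbourhood filter are upper semicontinuous. -/
theorem upperSemicontinuous_limsup_prod_nhds {ι : Type*} {l : Filter ι} [l.NeBot]
    {f : ι × X → ℝ}
    (hle : ∀ x, IsBoundedUnder (· ≤ ·) (l ×ˢ 𝓝 x) f)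
    (hge : ∀ x, IsBoundedUnder (· ≥ ·) (l ×ˢ 𝓝 x) f) :
    UpperSemicontinuous fun x => limsup f (l ×ˢ 𝓝 x) := by
  intro x c hc
  obtain ⟨b, hb, hbc⟩ := exists_between hc
  obtain ⟨p, hp, r, hr, hpr⟩ := eventually_prod_iff.1 (eventually_lt_of_limsup_lt hb (hle x))
  filter_upwards [eventually_eventually_nhds.2 hr] with y hy
  refine lt_of_le_of_lt (limsup_le_of_le (hge y).isCoboundedUnder_le ?_) hbc
  exact eventually_prod_iff.2 ⟨p, hp, r, hy, fun {i} hi {z} hz => (hpr hi hz).le⟩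

/-- Partial liminfs over a product with a neighbourhood filter are lower semicontinuous. -/
theorem lowerSemicontinuous_liminf_prod_nhds {ι : Type*} {l : Filter ι} [l.NeBot]
    {f : ι × X → ℝ}
    (hle : ∀ x, IsBoundedUnder (· ≤ ·) (l ×ˢ 𝓝 x) f)
    (hge : ∀ x, IsBoundedUnder (· ≥ ·) (l ×ˢ 𝓝 x) f) :
    LowerSemicontinuous fun x => liminf f (l ×ˢ 𝓝 x) := by
  intro x c hc
  obtain ⟨b, hcb, hb⟩ := exists_between hc
  obtain ⟨p, hp, r, hr, hpr⟩ := eventually_prod_iff.1 (eventually_lt_of_lt_liminf hb (hge x))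
  filter_upwards [eventually_eventually_nhds.2 hr] with y hy
  refine lt_of_lt_of_le hcb (le_liminf_of_le (hle y).isCoboundedUnder_ge ?_)
  exact eventually_prod_iff.2 ⟨p, hp, r, hy, fun {i} hi {z} hz => (hpr hi hz).le⟩

end Limits

section Radial

variable {E : Type*} [NormedAddCommGroup E] [InnerProductSpace ℝ E]

/-- The derivative of a radial function. -/
theorem hasFDerivAt_comp_norm_sub_sq {θ : ℝ → ℝ} (hθ : Differentiable ℝ θ) (x₀ y : E) :
    HasFDerivAt (fun y => θ (‖y - x₀‖ ^ 2))
      (deriv θ (‖y - x₀‖ ^ 2) • ((2 : ℝ) • innerSL ℝ (y - x₀))) y := by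
  have h1 : HasFDerivAt (fun y : E => ‖y - x₀‖ ^ 2) ((2 : ℝ) • innerSL ℝ (y - x₀)) y := by
    have := ((hasFDerivAt_id y).sub_const x₀).norm_sq
    refine this.congr_fderiv ?_
    ext v; simp
  exact (hθ _).hasDerivAt.comp_hasFDerivAt y h1

theorem fderiv_comp_norm_sub_sq_self {θ : ℝ → ℝ} (hθ : Differentiable ℝ θ) (x₀ : E) :
    fderiv ℝ (fun y => θ (‖y - x₀‖ ^ 2)) x₀ = 0 := by
  rw [(hasFDerivAt_comp_norm_sub_sq hθ x₀ x₀).fderiv]; simp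

theorem fderiv_fderiv_comp_norm_sub_sq_self {θ : ℝ → ℝ} (hθ : ContDiff ℝ 2 θ)
    (h0 : deriv θ 0 = 0) (x₀ : E) :
    fderiv ℝ (fderiv ℝ (fun y => θ (‖y - x₀‖ ^ 2))) x₀ = 0 := by
  have hd : Differentiable ℝ θ := hθ.differentiable (by norm_num)
  have hd' : Differentiable ℝ (deriv θ) := by
    have : ContDiff ℝ (1 + 1) θ := by convert hθ using 1; norm_num
    exact ((contDiff_succ_iff_deriv.1 this).2.2).differentiable (by norm_num)
  have hE : fderiv ℝ (fun y => θ (‖y - x₀‖ ^ 2)) =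
      fun y => deriv θ (‖y - x₀‖ ^ 2) • ((2 : ℝ) • innerSL ℝ (y - x₀)) :=
    funext fun y => (hasFDerivAt_comp_norm_sub_sq hd x₀ y).fderiv
  have hL : HasFDerivAt (fun y : E => (2 : ℝ) • innerSL ℝ (y - x₀)) ((2 : ℝ) • innerSL ℝ) x₀ :=
    (((innerSL ℝ : E →L[ℝ] E →L[ℝ] ℝ).hasFDerivAt).comp x₀
      ((hasFDerivAt_id x₀).sub_const x₀)).const_smul (2 : ℝ)
  have := (hasFDerivAt_comp_norm_sub_sq hd' x₀ x₀).smul hL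
  rw [hE]
  refine this.fderiv.trans ?_
  simp [h0]

end Radial

section Operator

variable {d : ℕ}

local notation "𝔼" => EuclideanSpace ℝ (Fin d)

/-- The integrand of the Lévy–Itô operator. -/
noncomputable def leviItoIntegrand (j : 𝔼 → 𝔼 → 𝔼) (φ : 𝔼 → ℝ) (x z : 𝔼) : ℝ :=
  φ (x + j x z) - φ x -
    ⟪gradient φ x, j x z⟫ * (closedBall (0 : 𝔼) 1).indicator (fun _ => (1 : ℝ)) z

theorem continuous_gradient {φ : 𝔼 → ℝ} (hφ : ContDiff ℝ 2 φ) : Continuous (gradient φ) :=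
  (InnerProductSpace.toDual ℝ 𝔼).symm.continuous.comp (hφ.continuous_fderiv (by norm_num))

theorem continuous_hessM {φ : 𝔼 → ℝ} (hφ : ContDiff ℝ 2 φ) : Continuous (hessM φ) := by
  refine continuous_matrix fun i k => ?_
  exact (continuous_eval_const _).comp (hφ.continuous_iteratedFDeriv (m := 2) le_rfl)

/-- Second-order Taylor estimate, uniform on balls. -/
theorem exists_taylor_bound {φ : 𝔼 → ℝ} (hφ : ContDiff ℝ 2 φ) (x₀ : 𝔼) (R : ℝ) :
    ∃ M, 0 ≤ M ∧ ∀ x ∈ closedBall x₀ R, ∀ y ∈ closedBall x₀ R,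
      |φ y - φ x - ⟪gradient φ x, y - x⟫| ≤ M * ‖y - x‖ ^ 2 := by
  have hd : Differentiable ℝ φ := hφ.differentiable (by norm_num)
  have hC : ContDiff ℝ 1 (fderiv ℝ φ) := hφ.fderiv_right (by norm_num)
  obtain ⟨M, hM⟩ := (isCompact_closedBall x₀ R).exists_bound_of_continuousOn
    (hC.continuous_fderiv (by norm_num)).continuousOn
  refine ⟨max M 0, le_max_right _ _, fun x hx y hy => ?_⟩
  have hlip : ∀ w ∈ closedBall x₀ R, ‖fderiv ℝ φ w - fderiv ℝ φ x‖ ≤ max M 0 * ‖w - x‖ :=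
    fun w hw => (convex_closedBall x₀ R).norm_image_sub_le_of_norm_fderiv_le
      (fun v _ => (hC.differentiable (by norm_num)) v)
      (fun v hv => (hM v hv).trans (le_max_left _ _)) hx hw
  have hseg := (convex_segment x y).norm_image_sub_le_of_norm_hasFDerivWithin_le' (f := φ)
      (f' := fderiv ℝ φ) (φ := fderiv ℝ φ x) (C := max M 0 * ‖y - x‖)
      (fun w _ => (hd w).hasFDerivAt.hasFDerivWithinAt)
      (fun w hw => (hlip w ((convex_closedBall x₀ R).segment_subset hx hy hw)).trans
        (mul_le_mul_of_nonneg_left (norm_sub_le_of_mem_segment hw) (le_max_right _ _)))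
      (left_mem_segment ℝ x y) (right_mem_segment ℝ x y)
  rw [Real.norm_eq_abs] at hseg
  have hg : ⟪gradient φ x, y - x⟫ = fderiv ℝ φ x (y - x) := by
    simp [gradient]
  rw [hg]
  refine hseg.trans (le_of_eq ?_)
  ring

theorem aestronglyMeasurable_leviItoIntegrand (μ : Measure 𝔼) {j : 𝔼 → 𝔼 → 𝔼}
    (hjm : Measurable (Function.uncurry j)) {φ : 𝔼 → ℝ} (hφ : Continuous φ) (x : 𝔼) :
    AEStronglyMeasurable (leviItoIntegrand j φ x) μ := by
  have hj : Measurable (j x) := hjm.of_uncurry_left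
  have h1 : Measurable fun z => φ (x + j x z) := hφ.measurable.comp (hj.const_add x)
  have h2 : Measurable fun z => ⟪gradient φ x, j x z⟫ := hj.const_inner
  exact ((h1.sub_const _).sub (h2.mul
    (measurable_const.indicator measurableSet_closedBall))).aestronglyMeasurable

theorem exists_leviItoIntegrand_bound {cb : ℝ} (hcb : 0 < cb) {j : 𝔼 → 𝔼 → 𝔼}
    (hjb : ∀ x z, ‖j x z‖ ≤ cb * ‖z‖) {φ : 𝔼 → ℝ} (hφ : ContDiff ℝ 2 φ)
    (hb : ∃ C, ∀ y, |φ y| ≤ C) (x₀ : 𝔼) :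
    ∃ K, ∀ x ∈ closedBall x₀ 1, ∀ z,
      ‖leviItoIntegrand j φ x z‖ ≤ K * min (‖z‖ ^ 2) 1 := by
  obtain ⟨C, hC⟩ := hb
  obtain ⟨M, hM0, hM⟩ := exists_taylor_bound hφ x₀ (1 + cb)
  refine ⟨max (M * cb ^ 2) (2 * C), fun x hx z => ?_⟩
  rw [mem_closedBall, dist_eq_norm] at hx
  unfold leviItoIntegrand
  by_cases hz : ‖z‖ ≤ 1
  · have hj1 : ‖j x z‖ ≤ cb := (hjb x z).trans (by nlinarith)
    have := hM x (by rw [mem_closedBall, dist_eq_norm]; linarith) (x + j x z) (by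
      rw [mem_closedBall, dist_eq_norm, add_sub_right_comm]
      exact (norm_add_le _ _).trans (add_le_add hx hj1))
    rw [add_sub_cancel_left] at this
    rw [Set.indicator_of_mem (by simpa using hz), mul_one, Real.norm_eq_abs,
      min_eq_left (by nlinarith [norm_nonneg z])]
    calc _ ≤ M * ‖j x z‖ ^ 2 := this
      _ ≤ M * (cb * ‖z‖) ^ 2 := by gcongr; exact hjb x z
      _ = M * cb ^ 2 * ‖z‖ ^ 2 := by ring
      _ ≤ _ := by gcongr; exact le_max_left _ _
  · rw [Set.indicator_of_notMem (by simpa using hz), mul_zero, sub_zero, Real.norm_eq_abs,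
      min_eq_right (by nlinarith), mul_one]
    refine le_trans ?_ (le_max_right _ _)
    have h1 := abs_le.1 (hC (x + j x z))
    have h2 := abs_le.1 (hC x)
    exact abs_le.2 ⟨by linarith, by linarith⟩

theorem integrable_min_norm_sq {μ : Measure 𝔼}
    (hLevy : ∫⁻ z, ENNReal.ofReal (min (‖z‖ ^ 2) 1) ∂μ < ⊤) :
    Integrable (fun z : 𝔼 => min (‖z‖ ^ 2) 1) μ := by
  refine ⟨(by fun_prop : Continuous fun z : 𝔼 => min (‖z‖ ^ 2) 1).aestronglyMeasurable, ?_⟩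
  rwa [hasFiniteIntegral_iff_ofReal (Eventually.of_forall fun z => by positivity)]

/-- `x ↦ I_LI[x,φ]` is continuous for bounded `C²` functions `φ`. -/
theorem continuous_ILI {μ : Measure 𝔼}
    (hLevy : ∫⁻ z, ENNReal.ofReal (min (‖z‖ ^ 2) 1) ∂μ < ⊤) {cb : ℝ} (hcb : 0 < cb)
    {j : 𝔼 → 𝔼 → 𝔼} (hjm : Measurable (Function.uncurry j))
    (hjb : ∀ x z, ‖j x z‖ ≤ cb * ‖z‖) (hjc : ∀ z, Continuous fun x => j x z)
    {φ : 𝔼 → ℝ} (hφ : ContDiff ℝ 2 φ) (hb : ∃ C, ∀ y, |φ y| ≤ C) :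
    Continuous fun x => ILI μ j x φ := by
  refine continuous_iff_continuousAt.2 fun x₀ => ?_
  obtain ⟨K, hK⟩ := exists_leviItoIntegrand_bound hcb hjb hφ hb x₀
  refine continuousAt_of_dominated (F := leviItoIntegrand j φ)
    (bound := fun z => K * min (‖z‖ ^ 2) 1)
    (Eventually.of_forall fun x => aestronglyMeasurable_leviItoIntegrand μ hjm hφ.continuous x)
    ?_ ((integrable_min_norm_sq hLevy).const_mul K) (Eventually.of_forall fun z => ?_)
  · filter_upwards [closedBall_mem_nhds x₀ one_pos] with x hx
    exact Eventually.of_forall (hK x hx)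
  · have h1 := hφ.continuous
    have h2 := hjc z
    have h3 := continuous_gradient hφ
    have : Continuous fun x => leviItoIntegrand j φ x z := by
      unfold leviItoIntegrand; fun_prop
    exact this.continuousAt

/-- A bounded smooth penalty, vanishing to fourth order at `x₀` and close to `C` far away. -/
noncomputable def quarticPenalty (C N : ℝ) (x₀ y : 𝔼) : ℝ :=
  C * ((‖y - x₀‖ ^ 2) ^ 2 / (N + (‖y - x₀‖ ^ 2) ^ 2))

section Penalty

variable {C N : ℝ} {x₀ : EuclideanSpace ℝ (Fin d)}

@[simp] theorem quarticPenalty_self : quarticPenalty C N x₀ x₀ = 0 := by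
  simp [quarticPenalty]

theorem quarticPenalty_nonneg (hC : 0 ≤ C) (hN : 0 < N) (y : 𝔼) :
    0 ≤ quarticPenalty C N x₀ y := by
  unfold quarticPenalty; positivity

theorem quarticPenalty_le (hC : 0 ≤ C) (hN : 0 < N) (y : 𝔼) : quarticPenalty C N x₀ y ≤ C :=
  mul_le_of_le_one_right hC (div_le_one_of_le₀ (by linarith) (by positivity))

theorem eq_of_quarticPenalty_nonpos (hC : 0 < C) (hN : 0 < N) {y : 𝔼}
    (h : quarticPenalty C N x₀ y ≤ 0) : y = x₀ := by
  by_contra hne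
  have : 0 < ‖y - x₀‖ := norm_pos_iff.2 (sub_ne_zero.2 hne)
  have : 0 < quarticPenalty C N x₀ y := by unfold quarticPenalty; positivity
  linarith

theorem half_le_quarticPenalty (hC : 0 ≤ C) (hN : 1 ≤ N) {y : 𝔼} (hy : N ≤ ‖y - x₀‖) :
    C / 2 ≤ quarticPenalty C N x₀ y := by
  have h1 : N ≤ ‖y - x₀‖ ^ 2 := by nlinarith
  have h2 : N ≤ (‖y - x₀‖ ^ 2) ^ 2 := by nlinarith
  have : 1 / 2 ≤ (‖y - x₀‖ ^ 2) ^ 2 / (N + (‖y - x₀‖ ^ 2) ^ 2) := by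
    rw [div_le_div_iff₀ (by norm_num) (by linarith)]; linarith
  have := mul_le_mul_of_nonneg_left this hC
  unfold quarticPenalty
  linarith

theorem quarticPenalty_le_mul_pow (hC : 0 ≤ C) (hN : 1 ≤ N) (y : 𝔼) :
    quarticPenalty C N x₀ y ≤ C * ‖y - x₀‖ ^ 4 := by
  unfold quarticPenalty
  refine mul_le_mul_of_nonneg_left ?_ hC
  have : (‖y - x₀‖ ^ 2) ^ 2 = ‖y - x₀‖ ^ 4 := by ring
  rw [this]
  exact div_le_self (by positivity) (by nlinarith [pow_nonneg (norm_nonneg (y - x₀)) 4])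

theorem contDiff_penaltyProfile (C : ℝ) (hN : 0 < N) :
    ContDiff ℝ 2 fun t : ℝ => C * (t ^ 2 / (N + t ^ 2)) :=
  contDiff_const.mul ((contDiff_id.pow 2).div (contDiff_const.add (contDiff_id.pow 2))
    fun t => (add_pos_of_pos_of_nonneg hN (sq_nonneg t)).ne')

theorem deriv_penaltyProfile_zero (C : ℝ) (hN : 0 < N) :
    deriv (fun t : ℝ => C * (t ^ 2 / (N + t ^ 2))) 0 = 0 := by
  have h : HasDerivAt (fun t : ℝ => t ^ 2) 0 0 := by simpa using hasDerivAt_pow 2 (0 : ℝ)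
  have := (h.div (h.const_add N) (by simpa using hN.ne')).const_mul C
  exact this.deriv.trans (by simp)

theorem contDiff_quarticPenalty (C : ℝ) (hN : 0 < N) (x₀ : 𝔼) :
    ContDiff ℝ 2 (quarticPenalty C N x₀) :=
  (contDiff_penaltyProfile C hN).comp ((contDiff_id.sub contDiff_const).norm_sq ℝ)

theorem gradient_add_quarticPenalty (C : ℝ) (hN : 0 < N) (x₀ : 𝔼) {φ : 𝔼 → ℝ}
    (hφ : ContDiff ℝ 2 φ) :
    gradient (fun y => φ y + quarticPenalty C N x₀ y) x₀ = gradient φ x₀ := by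
  have h : fderiv ℝ (quarticPenalty C N x₀) x₀ = 0 :=
    fderiv_comp_norm_sub_sq_self ((contDiff_penaltyProfile C hN).differentiable (by norm_num)) x₀
  unfold gradient
  rw [fderiv_fun_add (hφ.differentiable (by norm_num) x₀)
    ((contDiff_quarticPenalty C hN x₀).differentiable (by norm_num) x₀), h, add_zero]

theorem hessM_add_quarticPenalty (C : ℝ) (hN : 0 < N) (x₀ : 𝔼) {φ : 𝔼 → ℝ}
    (hφ : ContDiff ℝ 2 φ) :
    hessM (fun y => φ y + quarticPenalty C N x₀ y) x₀ = hessM φ x₀ := by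
  have h : fderiv ℝ (fderiv ℝ (quarticPenalty C N x₀)) x₀ = 0 :=
    fderiv_fderiv_comp_norm_sub_sq_self (contDiff_penaltyProfile C hN)
      (deriv_penaltyProfile_zero C hN) x₀
  have hg := contDiff_quarticPenalty C hN x₀
  have hsum : fderiv ℝ (fun y => φ y + quarticPenalty C N x₀ y) =
      fun y => fderiv ℝ φ y + fderiv ℝ (quarticPenalty C N x₀) y :=
    funext fun y => fderiv_fun_add (hφ.differentiable (by norm_num) y)
      (hg.differentiable (by norm_num) y)
  have hdiff : ∀ {ψ : 𝔼 → ℝ}, ContDiff ℝ 2 ψ → DifferentiableAt ℝ (fderiv ℝ ψ) x₀ :=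
    fun {ψ} hψ => (hψ.fderiv_right (m := 1) (by norm_num)).differentiable (by norm_num) x₀
  ext i k
  simp only [hessM, Matrix.of_apply, iteratedFDeriv_two_apply]
  rw [hsum, fderiv_fun_add (hdiff hφ) (hdiff hg), h, add_zero]

theorem quarticPenalty_add_le_min {cb : ℝ} (hC : 0 ≤ C) (hN : 1 ≤ N)
    {v z : 𝔼} (hv : ‖v‖ ≤ cb * ‖z‖) :
    quarticPenalty C N x₀ (x₀ + v) ≤ C * (cb ^ 4 + 1) * min (‖z‖ ^ 2) 1 := by
  have hcb4 : 0 ≤ cb ^ 4 := by positivity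
  by_cases hz : ‖z‖ ≤ 1
  · rw [min_eq_left (by nlinarith [norm_nonneg z])]
    have h1 := quarticPenalty_le_mul_pow (x₀ := x₀) hC hN (x₀ + v)
    rw [add_sub_cancel_left] at h1
    calc _ ≤ C * ‖v‖ ^ 4 := h1
      _ ≤ C * (cb * ‖z‖) ^ 4 := by gcongr
      _ = C * (cb ^ 4) * (‖z‖ ^ 2 * ‖z‖ ^ 2) := by ring
      _ ≤ C * (cb ^ 4 + 1) * (‖z‖ ^ 2 * 1) := by
        gcongr
        · linarith
        · nlinarith [norm_nonneg z]
      _ = _ := by ring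
  · rw [min_eq_right (by nlinarith)]
    have := quarticPenalty_le (x₀ := x₀) hC (by linarith) (x₀ + v) (N := N)
    nlinarith

theorem tendsto_quarticPenalty (C : ℝ) (x₀ y : 𝔼) :
    Tendsto (fun n : ℕ => quarticPenalty C ((n : ℝ) + 1) x₀ y) atTop (𝓝 0) := by
  have h1 : Tendsto (fun n : ℕ => (n : ℝ) + 1 + (‖y - x₀‖ ^ 2) ^ 2) atTop atTop :=
    tendsto_atTop_add_const_right _ _ (tendsto_atTop_add_const_right _ _
      tendsto_natCast_atTop_atTop)
  simpa [quarticPenalty] using ((tendsto_const_nhds (x := (‖y - x₀‖ ^ 2) ^ 2)).div_atTop h1).const_mul C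

end Penalty

theorem tendsto_ILI_add_quarticPenalty {μ : Measure 𝔼}
    (hLevy : ∫⁻ z, ENNReal.ofReal (min (‖z‖ ^ 2) 1) ∂μ < ⊤) {cb : ℝ} (hcb : 0 < cb)
    {j : 𝔼 → 𝔼 → 𝔼} (hjm : Measurable (Function.uncurry j))
    (hjb : ∀ x z, ‖j x z‖ ≤ cb * ‖z‖)
    {φ : 𝔼 → ℝ} (hφ : ContDiff ℝ 2 φ) (hb : ∃ C, ∀ y, |φ y| ≤ C) {C : ℝ} (hC : 0 ≤ C) (x₀ : 𝔼) :
    Tendsto (fun n : ℕ => ILI μ j x₀ fun y => φ y + quarticPenalty C ((n : ℝ) + 1) x₀ y) atTop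
      (𝓝 (ILI μ j x₀ φ)) := by
  obtain ⟨K, hK⟩ := exists_leviItoIntegrand_bound hcb hjb hφ hb x₀
  have hN : ∀ n : ℕ, (1 : ℝ) ≤ (n : ℝ) + 1 := fun n => by simp
  have hN0 : ∀ n : ℕ, (0 : ℝ) < (n : ℝ) + 1 := fun n => by positivity
  have hsplit : ∀ (n : ℕ) (z : 𝔼),
      leviItoIntegrand j (fun y => φ y + quarticPenalty C ((n : ℝ) + 1) x₀ y) x₀ z =
        leviItoIntegrand j φ x₀ z + quarticPenalty C ((n : ℝ) + 1) x₀ (x₀ + j x₀ z) := by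
    intro n z
    unfold leviItoIntegrand
    rw [gradient_add_quarticPenalty C (hN0 n) x₀ hφ]
    simp only [quarticPenalty_self]
    ring
  refine tendsto_integral_of_dominated_convergence
    (F := fun n => leviItoIntegrand j (fun y => φ y + quarticPenalty C ((n : ℝ) + 1) x₀ y) x₀)
    (f := leviItoIntegrand j φ x₀)
    (fun z => (K + C * (cb ^ 4 + 1)) * min (‖z‖ ^ 2) 1)
    (fun n => aestronglyMeasurable_leviItoIntegrand μ hjm
      (hφ.continuous.add (contDiff_quarticPenalty C (hN0 n) x₀).continuous) x₀)
    ((integrable_min_norm_sq hLevy).const_mul _)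
    (fun n => Eventually.of_forall fun z => ?_) (Eventually.of_forall fun z => ?_)
  · rw [hsplit, add_mul]
    refine (norm_add_le _ _).trans (add_le_add (hK x₀ (by simp) z) ?_)
    rw [Real.norm_of_nonneg (quarticPenalty_nonneg hC (hN0 n) _)]
    exact quarticPenalty_add_le_min hC (hN n) (hjb x₀ z)
  · simp only [hsplit]
    simpa using (tendsto_quarticPenalty C x₀ (x₀ + j x₀ z)).const_add (leviItoIntegrand j φ x₀ z)

/-- Penalized bounded usc functions attain their maximum, in a ball depending only on the
penalty. -/
theorem exists_forall_sub_add_quarticPenalty_le {v φ : 𝔼 → ℝ} {A B N : ℝ}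
    (hv : UpperSemicontinuous v) (hvA : ∀ y, |v y| ≤ A) (hφ : Continuous φ)
    (hφB : ∀ y, |φ y| ≤ B) (hN : 1 ≤ N) (x₀ : 𝔼) :
    ∃ x ∈ closedBall x₀ N, ∀ y,
      v y - (φ y + quarticPenalty (4 * (A + B) + 1) N x₀ y) ≤
        v x - (φ x + quarticPenalty (4 * (A + B) + 1) N x₀ x) := by
  set g := quarticPenalty (4 * (A + B) + 1) N x₀ with hg
  have hA : 0 ≤ A := (abs_nonneg _).trans (hvA x₀)
  have hB : 0 ≤ B := (abs_nonneg _).trans (hφB x₀)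
  have hgc : Continuous g := (contDiff_quarticPenalty _ (by linarith) x₀).continuous
  have husc : UpperSemicontinuous fun y => v y + -(φ y + g y) :=
    hv.add (hφ.add hgc).neg.upperSemicontinuous
  have hx₀ : x₀ ∈ closedBall x₀ N := mem_closedBall_self (by linarith)
  obtain ⟨x, hx, hmax⟩ := (husc.upperSemicontinuousOn _).exists_isMaxOn ⟨x₀, hx₀⟩
    (isCompact_closedBall x₀ N)
  simp only [← sub_eq_add_neg] at hmax
  refine ⟨x, hx, fun y => ?_⟩
  by_cases hy : y ∈ closedBall x₀ N
  · exact hmax hy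
  · refine le_trans ?_ (hmax hx₀)
    rw [mem_closedBall, dist_eq_norm, not_le] at hy
    have h1 : (4 * (A + B) + 1) / 2 ≤ g y := half_le_quarticPenalty (by linarith) hN hy.le
    have h0 : g x₀ = 0 := quarticPenalty_self
    have := abs_le.1 (hvA y)
    have := abs_le.1 (hvA x₀)
    have := abs_le.1 (hφB y)
    have := abs_le.1 (hφB x₀)
    simp only [h0]
    linarith

end Operator

section HalfRelaxed

variable {X : Type*} [TopologicalSpace X]

theorem eventually_fst_mem_Ioc (x : X) :
    ∀ᶠ q : ℝ × X in (𝓝[>] (0 : ℝ)) ×ˢ 𝓝 x, q.1 ∈ Set.Ioc (0 : ℝ) 1 :=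
  tendsto_fst.eventually (Ioc_mem_nhdsGT one_pos)

/-- Local uniform boundedness on compact sets gives boundedness along the limit filter. -/
theorem exists_eventually_abs_le [LocallyCompactSpace X] {f : ℝ × X → ℝ}
    (h : ∀ K : Set X, IsCompact K → ∃ C : ℝ, ∀ ε ∈ Set.Ioc (0 : ℝ) 1, ∀ ξ ∈ K, |f (ε, ξ)| ≤ C)
    (x : X) : ∃ C : ℝ, ∀ᶠ q in (𝓝[>] (0 : ℝ)) ×ˢ 𝓝 x, |f q| ≤ C := by
  obtain ⟨K, hK, hKx⟩ := exists_compact_mem_nhds x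
  obtain ⟨C, hC⟩ := h K hK
  refine ⟨C, ?_⟩
  filter_upwards [eventually_fst_mem_Ioc x, tendsto_snd.eventually hKx] with q hq hq'
  exact hC q.1 hq q.2 hq'

theorem isBoundedUnder_le_of_eventually_abs_le {α : Type*} {l : Filter α} {f : α → ℝ}
    (h : ∃ C : ℝ, ∀ᶠ q in l, |f q| ≤ C) : IsBoundedUnder (· ≤ ·) l f :=
  let ⟨C, hC⟩ := h
  isBoundedUnder_of_eventually_le (a := C) (hC.mono fun _ hq => (abs_le.1 hq).2)

theorem isBoundedUnder_ge_of_eventually_abs_le {α : Type*} {l : Filter α} {f : α → ℝ}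
    (h : ∃ C : ℝ, ∀ᶠ q in l, |f q| ≤ C) : IsBoundedUnder (· ≥ ·) l f :=
  let ⟨C, hC⟩ := h
  isBoundedUnder_of_eventually_ge (a := -C) (hC.mono fun _ hq => (abs_le.1 hq).1)

/-- A sequence along which the values asymptotically dominate the limsup. -/
theorem exists_seq_tendsto_limsup_sub_lt {α : Type*} {l : Filter α} [l.NeBot]
    [l.IsCountablyGenerated] {f : α → ℝ} (hge : IsBoundedUnder (· ≥ ·) l f) :
    ∃ q : ℕ → α, Tendsto q atTop l ∧ ∀ k : ℕ, limsup f l - 1 / ((k : ℝ) + 1) < f (q k) := by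
  obtain ⟨s, hs⟩ := l.exists_antitone_basis
  have : ∀ k : ℕ, ∃ q ∈ s k, limsup f l - 1 / ((k : ℝ) + 1) < f q := fun k => by
    have hlt : limsup f l - 1 / ((k : ℝ) + 1) < limsup f l := sub_lt_self _ (by positivity)
    obtain ⟨q, h1, h2⟩ := ((frequently_lt_of_lt_limsup hge.isCoboundedUnder_le hlt).and_eventually
      (hs.1.mem_of_mem trivial : s k ∈ l)).exists
    exact ⟨q, h2, h1⟩
  choose q hq1 hq2 using this
  exact ⟨q, hs.tendsto hq1, hq2⟩

end HalfRelaxed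

/-- stability of viscosity subsolutions under half-relaxed limits. -/
theorem statement10 {d : ℕ} (μ : Measure (EuclideanSpace ℝ (Fin d)))
    (hLevy : ∫⁻ z, ENNReal.ofReal (min (‖z‖ ^ 2) 1) ∂μ < ⊤)
    (cb : ℝ) (hcb : 0 < cb)
    (j : EuclideanSpace ℝ (Fin d) → EuclideanSpace ℝ (Fin d) → EuclideanSpace ℝ (Fin d))
    (hjm : Measurable (Function.uncurry j))
    (hjb : ∀ x z, ‖j x z‖ ≤ cb * ‖z‖)
    (hjc : ∀ z, Continuous fun x => j x z)
    (F : ℝ → EuclideanSpace ℝ (Fin d) → ℝ → EuclideanSpace ℝ (Fin d) →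
      Matrix (Fin d) (Fin d) ℝ → ℝ → ℝ)
    (hFc : ∀ ε ∈ Set.Ioc (0:ℝ) 1,
      Continuous fun ξ : EuclideanSpace ℝ (Fin d) × ℝ × EuclideanSpace ℝ (Fin d) ×
        Matrix (Fin d) (Fin d) ℝ × ℝ => F ε ξ.1 ξ.2.1 ξ.2.2.1 ξ.2.2.2.1 ξ.2.2.2.2)
    (hFe : ∀ ε ∈ Set.Ioc (0:ℝ) 1, DegEll (F ε))
    (hFb : ∀ K : Set (EuclideanSpace ℝ (Fin d) × ℝ × EuclideanSpace ℝ (Fin d) ×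
        Matrix (Fin d) (Fin d) ℝ × ℝ), IsCompact K →
      ∃ C : ℝ, ∀ ε ∈ Set.Ioc (0:ℝ) 1, ∀ ξ ∈ K,
        |F ε ξ.1 ξ.2.1 ξ.2.2.1 ξ.2.2.2.1 ξ.2.2.2.2| ≤ C)
    (u : ℝ → EuclideanSpace ℝ (Fin d) → ℝ)
    (hub : ∃ C : ℝ, ∀ ε ∈ Set.Ioc (0:ℝ) 1, ∀ x, |u ε x| ≤ C)
    (husc : ∀ ε ∈ Set.Ioc (0:ℝ) 1, UpperSemicontinuous (u ε))
    (hsub : ∀ ε ∈ Set.Ioc (0:ℝ) 1, IsSubsolution (F ε) μ j (u ε))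
    (ubar : EuclideanSpace ℝ (Fin d) → ℝ)
    (hubar : ubar = fun x => Filter.limsup
      (fun q : ℝ × EuclideanSpace ℝ (Fin d) => u q.1 q.2) ((𝓝[>] (0:ℝ)) ×ˢ 𝓝 x))
    (Flow : EuclideanSpace ℝ (Fin d) → ℝ → EuclideanSpace ℝ (Fin d) →
      Matrix (Fin d) (Fin d) ℝ → ℝ → ℝ)
    (hFlow : ∀ x a p X l, Flow x a p X l = Filter.liminf
      (fun q : ℝ × (EuclideanSpace ℝ (Fin d) × ℝ × EuclideanSpace ℝ (Fin d) ×
          Matrix (Fin d) (Fin d) ℝ × ℝ) =>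
        F q.1 q.2.1 q.2.2.1 q.2.2.2.1 q.2.2.2.2.1 q.2.2.2.2.2)
      ((𝓝[>] (0:ℝ)) ×ˢ 𝓝 (x, a, p, X, l))) :
    (∃ C, ∀ x, |ubar x| ≤ C) ∧ UpperSemicontinuous ubar ∧ IsSubsolution Flow μ j ubar := by
  obtain ⟨A, hA⟩ := hub
  have hA' : ∀ ε ∈ Set.Ioc (0:ℝ) 1, ∀ x, u ε x ∈ Set.Icc (-A) A :=
    fun ε hε x => abs_le.1 (hA ε hε x)
  have huev : ∀ x, ∃ C : ℝ, ∀ᶠ q : ℝ × EuclideanSpace ℝ (Fin d) in (𝓝[>] (0:ℝ)) ×ˢ 𝓝 x,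
      |u q.1 q.2| ≤ C := fun x =>
    ⟨A, (eventually_fst_mem_Ioc x).mono fun q hq => hA q.1 hq q.2⟩
  have hule := fun x => isBoundedUnder_le_of_eventually_abs_le (huev x)
  have huge := fun x => isBoundedUnder_ge_of_eventually_abs_le (huev x)
  have : LocallyCompactSpace (Matrix (Fin d) (Fin d) ℝ) :=
    inferInstanceAs (LocallyCompactSpace (Fin d → Fin d → ℝ))
  let G : ℝ × (EuclideanSpace ℝ (Fin d) × ℝ × EuclideanSpace ℝ (Fin d) ×
      Matrix (Fin d) (Fin d) ℝ × ℝ) → ℝ :=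
    fun q => F q.1 q.2.1 q.2.2.1 q.2.2.2.1 q.2.2.2.2.1 q.2.2.2.2.2
  have hGev := exists_eventually_abs_le (f := G) hFb
  have hGle := fun ξ => isBoundedUnder_le_of_eventually_abs_le (hGev ξ)
  have hGge := fun ξ => isBoundedUnder_ge_of_eventually_abs_le (hGev ξ)
  have hFlsc : LowerSemicontinuous fun ξ => liminf G ((𝓝[>] (0:ℝ)) ×ˢ 𝓝 ξ) :=
    lowerSemicontinuous_liminf_prod_nhds hGle hGge
  have hbar : ∀ x, |ubar x| ≤ A := fun x => by
    rw [hubar, abs_le]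
    exact ⟨le_limsup_of_frequently_le ((eventually_fst_mem_Ioc x).mono
        fun q hq => (hA' q.1 hq q.2).1).frequently (hule x),
      limsup_le_of_le (huge x).isCoboundedUnder_le
        ((eventually_fst_mem_Ioc x).mono fun q hq => (hA' q.1 hq q.2).2)⟩
  refine ⟨⟨A, hbar⟩, hubar ▸ upperSemicontinuous_limsup_prod_nhds hule huge, ?_⟩
  intro φ hφ hφb x₀ hmax
  obtain ⟨B, hB⟩ := hφb
  have hA0 : 0 ≤ A := (abs_nonneg _).trans (hbar x₀)
  have hB0 : 0 ≤ B := (abs_nonneg _).trans (hB x₀)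
  have hC0 : 0 < 4 * (A + B) + 1 := by linarith
  set C := 4 * (A + B) + 1 with hC
  have key : ∀ n : ℕ, Flow x₀ (ubar x₀) (gradient φ x₀) (hessM φ x₀)
      (ILI μ j x₀ fun y => φ y + quarticPenalty C ((n : ℝ) + 1) x₀ y) ≤ 0 := by
    intro n
    have hN : (1 : ℝ) ≤ (n : ℝ) + 1 := by simp
    have hN0 : (0 : ℝ) < (n : ℝ) + 1 := by positivity
    have hg := contDiff_quarticPenalty C hN0 x₀
    set g := quarticPenalty C ((n : ℝ) + 1) x₀ with hgdef
    have hgx₀ : g x₀ = 0 := quarticPenalty_self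
    have hg0 : ∀ y, 0 ≤ g y := quarticPenalty_nonneg hC0.le hN0
    have hΦ : ContDiff ℝ 2 fun y => φ y + g y := hφ.add hg
    have hΦb : ∃ D, ∀ y, |φ y + g y| ≤ D := ⟨B + C, fun y =>
      (abs_add_le _ _).trans (add_le_add (hB y) (by
        rw [abs_of_nonneg (hg0 y)]; exact quarticPenalty_le hC0.le hN0 y))⟩
    obtain ⟨q, hq, hqu⟩ := exists_seq_tendsto_limsup_sub_lt (huge x₀)
    obtain ⟨k₀, hk₀⟩ := eventually_atTop.1 (hq.eventually (eventually_fst_mem_Ioc x₀))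
    have hI : ∀ k, (q (k + k₀)).1 ∈ Set.Ioc (0:ℝ) 1 := fun k => hk₀ _ (by omega)
    choose x hxmem hxmax using fun k => exists_forall_sub_add_quarticPenalty_le
      (husc _ (hI k)) (hA _ (hI k)) hφ.continuous hB hN x₀
    obtain ⟨⟨y₀, a⟩, -, s, hs, hlim⟩ := ((isCompact_closedBall x₀ ((n : ℝ) + 1)).prod
      (isCompact_Icc (a := -A) (b := A))).tendsto_subseq
      (x := fun k => (x k, u (q (k + k₀)).1 (x k))) fun k => ⟨hxmem k, hA' _ (hI k) _⟩
    rw [nhds_prod_eq, tendsto_prod_iff'] at hlim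
    obtain ⟨hxlim, hulim⟩ := hlim
    have hst : Tendsto (fun k => s k + k₀) atTop atTop :=
      (tendsto_add_atTop_nat k₀).comp hs.tendsto_atTop
    have hqs := hq.comp hst
    have hεlim : Tendsto (fun k => (q (s k + k₀)).1) atTop (𝓝[>] 0) := tendsto_fst.comp hqs
    have hylim : Tendsto (fun k => (q (s k + k₀)).2) atTop (𝓝 x₀) := tendsto_snd.comp hqs
    have hpair : Tendsto (fun k => ((q (s k + k₀)).1, x (s k))) atTop
      ((𝓝[>] (0:ℝ)) ×ˢ 𝓝 y₀) := hεlim.prodMk hxlim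
    have ha_le : a ≤ ubar y₀ := by
      refine le_of_forall_gt fun c hc => ?_
      obtain ⟨b, hb, hbc⟩ := exists_between hc
      rw [hubar] at hb
      exact (le_of_tendsto hulim ((hpair.eventually
        (eventually_lt_of_limsup_lt hb (hule y₀))).mono fun k hk => hk.le)).trans_lt hbc
    have hle_a : ubar x₀ - (φ x₀ + g x₀) ≤ a - (φ y₀ + g y₀) := by
      have h1 : Tendsto (fun k => ubar x₀ - 1 / (((s k + k₀ : ℕ) : ℝ) + 1) -
          (φ (q (s k + k₀)).2 + g (q (s k + k₀)).2)) atTop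
          (𝓝 (ubar x₀ - 0 - (φ x₀ + g x₀))) :=
        (tendsto_const_nhds.sub (tendsto_one_div_add_atTop_nhds_zero_nat.comp hst)).sub
          ((hΦ.continuous.tendsto x₀).comp hylim)
      have h2 := hulim.sub ((hΦ.continuous.tendsto y₀).comp hxlim)
      rw [sub_zero] at h1
      refine le_of_tendsto_of_tendsto' h1 h2 fun k => ?_
      refine le_trans ?_ (hxmax (s k) (q (s k + k₀)).2)
      have := hqu (s k + k₀)
      rw [hubar]
      exact sub_le_sub_right this.le _
    have hy₀ : y₀ = x₀ := by
      refine eq_of_quarticPenalty_nonpos (C := C) hC0 hN0 ?_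
      have := hmax y₀
      rw [← hgdef]
      linarith
    subst hy₀
    have ha : a = ubar y₀ := le_antisymm ha_le (by linarith)
    subst ha
    have hξ : Tendsto (fun k => (x (s k), u (q (s k + k₀)).1 (x (s k)),
        gradient (fun y => φ y + g y) (x (s k)), hessM (fun y => φ y + g y) (x (s k)),
        ILI μ j (x (s k)) fun y => φ y + g y)) atTop
        (𝓝 (y₀, ubar y₀, gradient φ y₀, hessM φ y₀, ILI μ j y₀ fun y => φ y + g y)) := by
      refine hxlim.prodMk_nhds (hulim.prodMk_nhds (Tendsto.prodMk_nhds ?_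
        (Tendsto.prodMk_nhds ?_ ?_)))
      · rw [← gradient_add_quarticPenalty C hN0 y₀ hφ]
        exact ((continuous_gradient hΦ).tendsto y₀).comp hxlim
      · rw [← hessM_add_quarticPenalty C hN0 y₀ hφ]
        exact ((continuous_hessM hΦ).tendsto y₀).comp hxlim
      · exact ((continuous_ILI hLevy hcb hjm hjb hjc hΦ hΦb).tendsto y₀).comp hxlim
    rw [hFlow]
    by_contra! hpos
    obtain ⟨k, hk⟩ := ((hεlim.prodMk hξ).eventually
      (eventually_lt_of_lt_liminf hpos (hGge _))).exists
    exact absurd (hsub _ (hI (s k)) _ hΦ hΦb (x (s k)) (hxmax (s k))) (not_le.2 hk)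
  by_contra! hpos
  rw [hFlow] at hpos
  have hξ : Tendsto (fun n : ℕ => (x₀, ubar x₀, gradient φ x₀, hessM φ x₀,
      ILI μ j x₀ fun y => φ y + quarticPenalty C ((n : ℝ) + 1) x₀ y)) atTop
      (𝓝 (x₀, ubar x₀, gradient φ x₀, hessM φ x₀, ILI μ j x₀ φ)) :=
    tendsto_const_nhds.prodMk_nhds (tendsto_const_nhds.prodMk_nhds
      (tendsto_const_nhds.prodMk_nhds (tendsto_const_nhds.prodMk_nhds
        (tendsto_ILI_add_quarticPenalty hLevy hcb hjm hjb hφ ⟨B, hB⟩ hC0.le x₀))))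
  obtain ⟨n, hn⟩ := (hξ.eventually (hFlsc _ _ hpos)).exists
  have := key n
  rw [hFlow] at this
  exact absurd this (not_le.2 hn)
end
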